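/- arXiv:1109.2765 — 2 statements merged into one kernel-verified Lean document; each statement's English description precedes it below -/
import Mathlib

section
/- Let R be a finitely generated subring of a number field k, let δ be a non-zero element of R that is not a root of unity, and let x₁, x₂, …, x_j be non-zero elements of R. Then there exists a positive integer n with the following property: for each integer m ≥ n, there exist a finite field F and a ring homomorphism η : R → F such that the multiplicative order of η(δ) is equal to m and η(x_i) ≠ 0 for each 1 ≤ i ≤ j. -/
set_option synthInstance.maxHeartbeats 400000
set_option maxHeartbeats 800000

section

open Polynomial Matrix

/-- A zero estimate for exponential polynomials in `x` and `δ ^ x` with polynomial coefficients. -/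
theorem exists_eval_add_mul_pow_ne_zero {K : Type*} [Field K] [CharZero K] {δ : K}
    (hδ : Function.Injective fun n : ℕ => δ ^ n) {n : ℕ} (hn : 0 < n) {e : Fin n → ℕ}
    (he : Function.Injective e) {P : Fin n → K[X]} (hP : ∀ i, P i ≠ 0) {d : ℕ}
    (hd : ∀ i, (P i).natDegree ≤ d) {κ : ℤ} {m R S : ℕ} (hcop : IsCoprime κ (m : ℤ)) (hm : 0 < m)
    (hR : R ≤ m) (hRS : n * d < R * S) :
    ∃ r < n + R, ∃ s < S, ∑ i, (P i).eval ((r * κ + s * m : ℤ) : K) * δ ^ (r * e i) ≠ 0 := by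
  by_contra! hvan
  have hδ0 : δ ≠ 0 := by
    rintro rfl
    have := @hδ 1 2 (by simp)
    omega
  let M : Matrix (Fin n) (Fin n) K[X] := fun r i =>
    (P i).comp (X + C ((((r : ℕ) : ℤ) * κ : ℤ) : K)) * C (δ ^ ((r : ℕ) * e i))
  have hMdeg : ∀ r i, (M r i).natDegree = (P i).natDegree := fun r i => by
    simp only [M]
    rw [natDegree_mul_C (pow_ne_zero _ hδ0), natDegree_comp, natDegree_X_add_C, mul_one]
  have hMlead : ∀ r i, (M r i).leadingCoeff = (P i).leadingCoeff * δ ^ ((r : ℕ) * e i) := fun r i => by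
    simp only [M]
    rw [leadingCoeff_mul, leadingCoeff_C, leadingCoeff_comp (by rw [natDegree_X_add_C]; simp),
      leadingCoeff_X_add_C, one_pow, mul_one]
  have hdet0 : M.det = 0 := by
    let f : Fin R × Fin S → K := fun z => (((z.1 : ℕ) * κ + (z.2 : ℕ) * m : ℤ) : K)
    have hf : Function.Injective f := by
      rintro ⟨⟨r, hr⟩, ⟨s, hs⟩⟩ ⟨⟨r', hr'⟩, ⟨s', hs'⟩⟩ h
      have h1 : (r : ℤ) * κ + s * m = r' * κ + s' * m := by
        simp only [f] at h
        exact_mod_cast h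
      have h2 : (m : ℤ) ∣ (r - r') := by
        refine hcop.symm.dvd_of_dvd_mul_right ⟨s' - s, by linear_combination h1⟩
      have h3 : (r : ℤ) - r' = 0 :=
        Int.eq_zero_of_abs_lt_dvd h2 (by rw [abs_lt]; omega)
      have h4 : (s : ℤ) = s' := by
        have hm' : (m : ℤ) ≠ 0 := by positivity
        have : (s : ℤ) * m = s' * m := by linear_combination h1 - κ * h3
        exact mul_right_cancel₀ hm' this
      simp only [Prod.mk.injEq, Fin.mk.injEq]
      omega
    refine eq_zero_of_natDegree_lt_card_of_eval_eq_zero _ hf ?_ ?_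
    · rintro ⟨⟨r, hr⟩, ⟨s, hs⟩⟩
      rw [← coe_evalRingHom, RingHom.map_det, ← Matrix.exists_mulVec_eq_zero_iff]
      refine ⟨fun i => δ ^ (r * e i), ?_, ?_⟩
      · intro h
        exact pow_ne_zero _ hδ0 (congrFun h ⟨0, hn⟩)
      · ext r'
        have := hvan (r' + r) (by omega) s hs
        refine Eq.trans ?_ this
        simp only [Matrix.mulVec, dotProduct, f]
        refine Finset.sum_congr rfl fun i _ => ?_
        change eval _ (M r' i) * _ = _
        simp only [M, eval_mul, eval_comp,
          eval_add, eval_X, eval_C]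
        rw [mul_assoc, ← pow_add]
        congr 2
        · push_cast; ring
        · ring
    · simp only [Fintype.card_prod, Fintype.card_fin]
      refine lt_of_le_of_lt ?_ hRS
      rw [Matrix.det_apply]
      refine natDegree_sum_le_of_forall_le _ _ fun τ _ => ?_
      refine (natDegree_smul_le _ _).trans ((natDegree_prod_le _ _).trans ?_)
      refine (Finset.sum_le_card_nsmul _ _ d fun i _ => ?_).trans (by simp)
      rw [hMdeg]; exact hd i
  have hcoeff : M.det.coeff (∑ i, (P i).natDegree) =
      (Matrix.of fun r i : Fin n => (P i).leadingCoeff * (δ ^ e i) ^ (r : ℕ)).det := by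
    rw [Matrix.det_apply, Matrix.det_apply, finsetSum_coeff]
    refine Finset.sum_congr rfl fun τ _ => ?_
    have h1 : (∏ i, M (τ i) i).natDegree = ∑ i, (P i).natDegree := by
      rw [natDegree_prod _ _ fun i _ => ?_]
      · exact Finset.sum_congr rfl fun i _ => hMdeg _ _
      · rw [← leadingCoeff_ne_zero, hMlead]
        exact mul_ne_zero (leadingCoeff_ne_zero.2 (hP i)) (pow_ne_zero _ hδ0)
    rw [coeff_smul, ← h1, coeff_natDegree, leadingCoeff_prod]
    congr 1
    refine Finset.prod_congr rfl fun i _ => ?_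
    rw [hMlead, Matrix.of_apply, ← pow_mul, mul_comm (e i)]
  rw [hdet0, coeff_zero] at hcoeff
  have h2 : (Matrix.of fun r i : Fin n => (P i).leadingCoeff * (δ ^ e i) ^ (r : ℕ)) =
      Matrix.of fun r i => (P i).leadingCoeff * (Matrix.vandermonde fun i => δ ^ e i)ᵀ r i := by
    ext; simp [Matrix.vandermonde]
  rw [h2, Matrix.det_mul_row, Matrix.det_transpose] at hcoeff
  refine mul_ne_zero (Finset.prod_ne_zero_iff.2 fun i _ => leadingCoeff_ne_zero.2 (hP i)) ?_
    hcoeff.symm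
  exact Matrix.det_vandermonde_ne_zero_iff.2 fun i j h => he (hδ h)

end

theorem exists_int_vec_norm_sum_le {β : Type*} [Fintype β] {N K : ℕ} (hN : 0 < N) (hK : 0 < K)
    (γ : Fin N → β → ℂ) {G H : ℝ} (hG : 1 ≤ G) (hγ : ∀ n b, ‖γ n b‖ ≤ G)
    (hcard : 2 * N * (K + 1) ≤ Fintype.card β) {Q : ℕ} (hQ : 0 < Q) (hH0 : 0 ≤ H)
    (hH : 2 * Fintype.card β * Q * G ≤ H ^ K) :
    ∃ t : β → ℤ, t ≠ 0 ∧ (∀ b, |(t b : ℝ)| ≤ H) ∧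
      ∀ n, ‖∑ b, γ n b * t b‖ ≤ 2 * Fintype.card β * H / Q := by
  classical
  let A : Matrix (Fin N × Bool) β ℤ := fun z b =>
    ⌊(Q : ℝ) * cond z.2 (γ z.1 b).re (γ z.1 b).im⌋
  let := Matrix.seminormedAddCommGroup (m := Fin N × Bool) (n := β) (α := ℤ)
  have hQ' : (1 : ℝ) ≤ Q := by exact_mod_cast hQ
  have hA : ‖A‖ ≤ 2 * Q * G := by
    refine (Matrix.norm_le_iff (by positivity)).2 fun z b => ?_
    have h1 : |cond z.2 (γ z.1 b).re (γ z.1 b).im| ≤ G := by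
      cases z.2
      · exact (Complex.abs_im_le_norm _).trans (hγ _ _)
      · exact (Complex.abs_re_le_norm _).trans (hγ _ _)
    rw [Int.norm_eq_abs]
    set y := cond z.2 (γ z.1 b).re (γ z.1 b).im
    have h2 := Int.floor_le ((Q : ℝ) * y)
    have h3 := Int.lt_floor_add_one ((Q : ℝ) * y)
    have h4 : |(Q : ℝ) * y| ≤ Q * G := by
      rw [abs_mul, Nat.abs_cast]; gcongr
    have h5 : 1 ≤ (Q : ℝ) * G := one_le_mul_of_one_le_of_one_le hQ' hG
    rw [abs_le] at h4 ⊢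
    simp only [A]
    constructor <;> linarith [h4.1, h4.2]
  have hc1 : Fintype.card (Fin N × Bool) = 2 * N := by simp [mul_comm]
  obtain ⟨t, ht0, hAt, ht⟩ := Int.Matrix.exists_ne_zero_int_vec_norm_le A
    (by rw [hc1]; nlinarith) (by rw [hc1]; omega)
  have htH : ∀ b, |(t b : ℝ)| ≤ H := fun b => by
    rw [← Int.norm_eq_abs]
    refine (norm_le_pi_norm t b).trans (ht.trans ?_)
    have hL : (2 * N * (K + 1) : ℝ) ≤ Fintype.card β := by exact_mod_cast hcard
    have hN' : (1 : ℝ) ≤ N := by exact_mod_cast hN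
    have hK' : (1 : ℝ) ≤ K := by exact_mod_cast hK
    have hL1 : (1 : ℝ) ≤ Fintype.card β := by nlinarith
    have hQG : 1 ≤ (Q : ℝ) * G := one_le_mul_of_one_le_of_one_le hQ' hG
    have hbase : 1 ≤ 2 * Fintype.card β * Q * G := by nlinarith
    calc _ ≤ (2 * Fintype.card β * Q * G : ℝ) ^
        (((Fintype.card (Fin N × Bool) : ℕ) : ℝ) / (Fintype.card β - (Fintype.card (Fin N × Bool) : ℕ))) := by
          refine Real.rpow_le_rpow (by positivity) ?_ ?_
          · rw [show (2 * Fintype.card β * Q * G : ℝ) = Fintype.card β * (2 * Q * G) by ring]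
            gcongr
            exact max_le (by nlinarith) hA
          · rw [hc1]; push_cast
            refine div_nonneg (by positivity) (by nlinarith)
      _ ≤ (2 * Fintype.card β * Q * G : ℝ) ^ ((K : ℝ)⁻¹) := by
          refine Real.rpow_le_rpow_of_exponent_le hbase ?_
          rw [hc1]; push_cast
          rw [div_le_iff₀ (by nlinarith), ← div_eq_inv_mul, le_div_iff₀ (by positivity)]
          nlinarith
      _ ≤ (H ^ K) ^ ((K : ℝ)⁻¹) := by
          refine Real.rpow_le_rpow (by positivity) hH (by positivity)
      _ = H := Real.pow_rpow_inv_natCast hH0 hK.ne'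
  refine ⟨t, ht0, htH, fun n => ?_⟩
  have key : ∀ c : Bool, |∑ b, cond c (γ n b).re (γ n b).im * (t b : ℝ)| ≤ Fintype.card β * H / Q := by
    intro c
    have h0 : ∑ b, (A (n, c) b : ℝ) * (t b : ℝ) = 0 := by
      have := congrFun hAt (n, c)
      simp only [Matrix.mulVec, dotProduct, Pi.zero_apply] at this
      exact_mod_cast this
    rw [le_div_iff₀ (by positivity), ← Nat.abs_cast Q, ← abs_mul, Finset.sum_mul]
    calc _ = |∑ b, ((Q : ℝ) * cond c (γ n b).re (γ n b).im - A (n, c) b) * (t b : ℝ)| := by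
          congr 1
          simp only [sub_mul, Finset.sum_sub_distrib, h0, sub_zero]
          exact Finset.sum_congr rfl fun b _ => by ring
      _ ≤ ∑ b : β, H := by
          refine (Finset.abs_sum_le_sum_abs _ _).trans (Finset.sum_le_sum fun b _ => ?_)
          rw [abs_mul, ← one_mul H]
          gcongr
          · simp only [A]
            rw [Int.self_sub_floor, abs_of_nonneg (Int.fract_nonneg _)]
            exact (Int.fract_lt_one _).le
          · exact htH b
      _ = _ := by simp
  refine (Complex.norm_le_abs_re_add_abs_im _).trans ?_
  have h1 := key true
  have h2 := key false
  simp only [cond_true, cond_false] at h1 h2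
  rw [Complex.re_sum, Complex.im_sum]
  have h3 : ∀ b, (γ n b * (t b : ℂ)).re = (γ n b).re * (t b : ℝ) := fun b => by simp
  have h4 : ∀ b, (γ n b * (t b : ℂ)).im = (γ n b).im * (t b : ℝ) := fun b => by simp
  simp only [h3, h4]
  calc _ ≤ Fintype.card β * H / Q + Fintype.card β * H / Q := add_le_add h1 h2
    _ = _ := by ring

open NumberField in
theorem exists_one_le_norm_sum_mul_pow (k : Type*) [Field k] [NumberField k] (δ : k) :
    ∃ q : ℝ, 1 ≤ q ∧ ∀ (σ : k →+* ℂ) {ι : Type} (I : Finset ι) (c : ι → ℤ) (e : ι → ℕ) (E : ℕ) (Y : ℝ),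
      (∀ i ∈ I, e i ≤ E) → 1 ≤ Y → ∑ i ∈ I, |(c i : ℝ)| ≤ Y → ∑ i ∈ I, (c i : k) * δ ^ e i ≠ 0 →
      1 ≤ ‖σ (∑ i ∈ I, (c i : k) * δ ^ e i)‖ * (Y * q ^ E) ^ Module.finrank ℚ k := by
  obtain ⟨d, hd0, hd⟩ := ((IsFractionRing.isAlgebraic_iff ℤ ℚ k).2 (Algebra.IsAlgebraic.isAlgebraic δ)).exists_integral_multiple
  let M : ℝ := 1 + ∑ σ : k →+* ℂ, ‖σ δ‖
  have hM1 : 1 ≤ M := le_add_of_nonneg_right (by positivity)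
  have hM : ∀ σ : k →+* ℂ, ‖σ δ‖ ≤ M := fun σ =>
    (Finset.single_le_sum (f := fun σ : k →+* ℂ => ‖σ δ‖) (fun _ _ => norm_nonneg _)
      (Finset.mem_univ σ)).trans (by simp [M])
  have hd1 : (1 : ℝ) ≤ |(d : ℝ)| := by exact_mod_cast Int.one_le_abs hd0
  refine ⟨|(d : ℝ)| * M, one_le_mul_of_one_le_of_one_le hd1 hM1, ?_⟩
  intro σ ι I c e E Y he hY hc hne
  set ξ := ∑ i ∈ I, (c i : k) * δ ^ e i with hξ
  have hint : IsIntegral ℤ ((d : k) ^ E * ξ) := by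
    rw [hξ, Finset.mul_sum]
    refine IsIntegral.sum _ fun i hi => ?_
    have : (d : k) ^ E * ((c i : k) * δ ^ e i) =
        (d : k) ^ (E - e i) * (c i : k) * (d • δ) ^ e i := by
      rw [zsmul_eq_mul, mul_pow, ← Nat.sub_add_cancel (he i hi), pow_add, Nat.add_sub_cancel]
      ring
    rw [this]
    have hz : ∀ z : ℤ, IsIntegral ℤ (z : k) := fun z => isIntegral_algebraMap (R := ℤ) (A := k) (x := z)
    exact (((hz d).pow _).mul (hz _)).mul (hd.pow _)
  have hne' : (d : k) ^ E * ξ ≠ 0 := mul_ne_zero (pow_ne_zero _ (by exact_mod_cast hd0)) hne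
  obtain ⟨z, hz⟩ : ∃ z : ℤ, (z : ℚ) = Algebra.norm ℚ ((d : k) ^ E * ξ) := by
    obtain ⟨z, hz⟩ := IsIntegrallyClosed.isIntegral_iff.1 (Algebra.isIntegral_norm ℚ hint)
    exact ⟨z, by simpa using hz⟩
  have hz0 : z ≠ 0 := by
    rintro rfl
    rw [Int.cast_zero] at hz
    exact hne' (Algebra.norm_eq_zero_iff.1 hz.symm)
  have hnorm : (1 : ℝ) ≤ ∏ τ : k →+* ℂ, ‖τ ((d : k) ^ E * ξ)‖ := by
    have h1 := Algebra.norm_eq_prod_embeddings ℚ ℂ ((d : k) ^ E * ξ)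
    rw [← hz] at h1
    have h2 := congrArg norm h1
    rw [norm_prod, ← (RingHom.equivRatAlgHom (R := k) (S := ℂ)).prod_comp] at h2
    simp only [RingHom.equivRatAlgHom_apply, RingHom.toRatAlgHom_apply] at h2
    rw [← h2]
    simp only [eq_ratCast, Rat.cast_intCast, Complex.norm_intCast]
    exact_mod_cast Int.one_le_abs hz0
  have hle : ∀ τ : k →+* ℂ, ‖τ ((d : k) ^ E * ξ)‖ ≤ Y * (|(d : ℝ)| * M) ^ E := by
    intro τ
    rw [map_mul, norm_mul, map_pow, map_intCast, norm_pow, Complex.norm_intCast, mul_pow]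
    have : ‖τ ξ‖ ≤ Y * M ^ E := by
      rw [hξ, map_sum]
      refine (norm_sum_le _ _).trans ?_
      calc _ ≤ ∑ i ∈ I, |(c i : ℝ)| * M ^ E := by
            refine Finset.sum_le_sum fun i hi => ?_
            rw [map_mul, map_intCast, norm_mul, Complex.norm_intCast, map_pow, norm_pow]
            gcongr
            exact (pow_le_pow_left₀ (norm_nonneg _) (hM τ) _).trans (pow_le_pow_right₀ hM1 (he i hi))
        _ ≤ _ := by rw [← Finset.sum_mul]; gcongr
    calc _ ≤ |(d : ℝ)| ^ E * (Y * M ^ E) := by gcongr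
      _ = _ := by ring
  have hB1 : 1 ≤ Y * (|(d : ℝ)| * M) ^ E :=
    one_le_mul_of_one_le_of_one_le hY (one_le_pow₀ (one_le_mul_of_one_le_of_one_le hd1 hM1))
  have hcard : Fintype.card (k →+* ℂ) = Module.finrank ℚ k := Embeddings.card k ℂ
  classical
  rw [← Finset.mul_prod_erase _ _ (Finset.mem_univ σ)] at hnorm
  have hprod : ∏ τ ∈ Finset.univ.erase σ, ‖τ ((d : k) ^ E * ξ)‖ ≤
      (Y * (|(d : ℝ)| * M) ^ E) ^ (Module.finrank ℚ k - 1) := by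
    refine (Finset.prod_le_prod (fun _ _ => norm_nonneg _) fun τ _ => hle τ).trans_eq ?_
    rw [Finset.prod_const, Finset.card_erase_of_mem (Finset.mem_univ σ), Finset.card_univ, hcard]
  have hσ : ‖σ ((d : k) ^ E * ξ)‖ ≤ ‖σ ξ‖ * (Y * (|(d : ℝ)| * M) ^ E) := by
    rw [map_mul, norm_mul, map_pow, map_intCast, norm_pow, Complex.norm_intCast, mul_comm]
    gcongr
    rw [mul_pow]
    calc _ = 1 * (|(d : ℝ)| ^ E * 1) := by ring
      _ ≤ Y * (|(d : ℝ)| ^ E * M ^ E) := by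
        refine mul_le_mul hY ?_ (by positivity) (by positivity)
        exact mul_le_mul_of_nonneg_left (one_le_pow₀ hM1 (n := E)) (by positivity)
  calc (1 : ℝ) ≤ _ := hnorm
    _ ≤ (‖σ ξ‖ * (Y * (|(d : ℝ)| * M) ^ E)) * (Y * (|(d : ℝ)| * M) ^ E) ^ (Module.finrank ℚ k - 1) :=
      mul_le_mul hσ hprod (by positivity) (by positivity)
    _ = _ := by
      rw [mul_assoc, ← pow_succ', Nat.sub_add_cancel Module.finrank_pos]

theorem Complex.norm_exp_sub_sum_le_exp {z : ℂ} {W : ℝ} (hz : ‖z‖ ≤ W) (n : ℕ) :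
    ‖Complex.exp z - ∑ j ∈ Finset.range n, z ^ j / j.factorial‖ ≤ Real.exp (3 * W - n) := by
  set w := ‖z‖
  have hw : 0 ≤ w := norm_nonneg z
  have hsum : ∀ y : ℝ, Summable fun j : ℕ => y ^ j / j.factorial := Real.summable_pow_div_factorial
  have hexp : ∀ y : ℝ, Real.exp y = ∑' j : ℕ, y ^ j / j.factorial := fun y => by
    rw [Real.exp_eq_exp_ℝ, NormedSpace.exp_eq_tsum_div]
  refine (Complex.norm_exp_sub_sum_le_exp_norm_sub_sum z n).trans ?_
  rw [hexp, ← (hsum ‖z‖).sum_add_tsum_nat_add n, add_sub_cancel_left]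
  have hew : 0 ≤ Real.exp 1 * w := by positivity
  calc ∑' j : ℕ, ‖z‖ ^ (j + n) / (j + n).factorial
      ≤ ∑' j : ℕ, Real.exp (-n) * ((Real.exp 1 * w) ^ (j + n) / (j + n).factorial) := by
        refine Summable.tsum_le_tsum (fun j => ?_) ((summable_nat_add_iff n).2 (hsum _))
          (((summable_nat_add_iff n).2 (hsum _)).mul_left _)
        rw [← mul_div_assoc]
        gcongr
        rw [mul_pow, ← mul_assoc, ← Real.exp_nat_mul, ← Real.exp_add]
        refine le_mul_of_one_le_left (by positivity) (Real.one_le_exp ?_)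
        push_cast
        have : (0 : ℝ) ≤ j := by positivity
        linarith
    _ ≤ Real.exp (-n) * Real.exp (Real.exp 1 * w) := by
        rw [tsum_mul_left, hexp (Real.exp 1 * w), ← (hsum (Real.exp 1 * w)).sum_add_tsum_nat_add n]
        gcongr
        refine le_add_of_nonneg_left (Finset.sum_nonneg fun j _ => by positivity)
    _ ≤ _ := by
        rw [← Real.exp_add]
        refine Real.exp_le_exp.2 ?_
        have := Real.exp_one_lt_d9
        nlinarith

open Complex in
/-- `X ^ n` times the `n`-th Taylor coefficient of `(m x) ^ a * exp (2 π i b x)`. -/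
noncomputable def scaledTaylorCoeff (m : ℕ) (X : ℝ) (n a b : ℕ) : ℂ :=
  if a ≤ n then (m : ℂ) ^ a * (X : ℂ) ^ n * (2 * Real.pi * I * b) ^ (n - a) / (n - a).factorial else 0

open Complex in
theorem norm_scaledTaylorCoeff_le {m : ℕ} (hm : 0 < m) {X : ℝ} (hX : 1 ≤ X) {n a b A B : ℕ} (ha : a ≤ A)
    (hb : b ≤ B) :
    ‖scaledTaylorCoeff m X n a b‖ ≤ (m * X) ^ A * Real.exp (2 * Real.pi * B * X) := by
  have hm' : (1 : ℝ) ≤ m := by exact_mod_cast hm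
  rw [scaledTaylorCoeff]
  split_ifs with h
  · obtain ⟨j, rfl⟩ := Nat.exists_eq_add_of_le h
    simp only [Nat.add_sub_cancel_left, norm_div, norm_mul, norm_pow, norm_natCast, norm_real,
      norm_I, RCLike.norm_ofNat, Real.norm_eq_abs, abs_of_pos Real.pi_pos, abs_of_nonneg (zero_le_one.trans hX),
      mul_one]
    calc _ = (m * X) ^ a * ((2 * Real.pi * b * X) ^ j / j.factorial) := by ring
      _ ≤ (m * X) ^ A * Real.exp (2 * Real.pi * b * X) := by
        gcongr
        · exact one_le_mul_of_one_le_of_one_le hm' hX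
        · exact Real.pow_div_factorial_le_exp _ (by positivity) _
      _ ≤ _ := by gcongr
  · rw [norm_zero]; positivity

open Complex in
theorem norm_sum_mul_pow_mul_exp_le {m A B N : ℕ} (hm : 0 < m) {X x H ε M : ℝ} (hX : 1 ≤ X)
    (hx : |x| ≤ X) (hM : M + A ≤ N) (hAN : A ≤ N) {t : Fin A × Fin B → ℤ} (ht : ∀ z, |(t z : ℝ)| ≤ H)
    (hε : ∀ n : Fin N, ‖∑ z : Fin A × Fin B, scaledTaylorCoeff m X n z.1 z.2 * t z‖ ≤ ε) :
    ‖∑ z : Fin A × Fin B, t z * ((m * x : ℝ) : ℂ) ^ (z.1 : ℕ) *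
        exp (2 * Real.pi * I * (z.2 : ℕ) * x)‖ ≤
      N * ε + (A * B : ℕ) * (H * (m * X) ^ A * Real.exp (3 * (2 * Real.pi * B * X) - M)) := by
  have hm' : (1 : ℝ) ≤ m := by exact_mod_cast hm
  have hX0 : (X : ℂ) ≠ 0 := by exact_mod_cast (zero_lt_one.trans_le hX).ne'
  have key : ∑ n : Fin N, ((x / X : ℝ) : ℂ) ^ (n : ℕ) *
      ∑ z : Fin A × Fin B, scaledTaylorCoeff m X n z.1 z.2 * t z =
      ∑ z : Fin A × Fin B, t z * ((m * x : ℝ) : ℂ) ^ (z.1 : ℕ) *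
        ∑ j ∈ Finset.range (N - z.1), (2 * Real.pi * I * (z.2 : ℕ) * x) ^ j / j.factorial := by
    simp only [Finset.mul_sum]
    rw [Finset.sum_comm]
    refine Finset.sum_congr rfl fun z _ => ?_
    rw [Fin.sum_univ_eq_sum_range
      (fun n => ((x / X : ℝ) : ℂ) ^ n * (scaledTaylorCoeff m X n z.1 z.2 * t z)) N]
    have hz : (z.1 : ℕ) ≤ N := z.1.2.le.trans hAN
    conv_lhs => rw [← Nat.add_sub_cancel' hz]
    rw [Finset.sum_range_add, Finset.sum_eq_zero, zero_add]
    · refine Finset.sum_congr rfl fun j _ => ?_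
      rw [scaledTaylorCoeff, if_pos (Nat.le_add_right _ _), Nat.add_sub_cancel_left]
      push_cast
      rw [div_pow]
      field_simp
      ring
    · intro n hn
      rw [scaledTaylorCoeff, if_neg (by simpa using hn)]
      simp
  have h1 : ‖∑ n : Fin N, ((x / X : ℝ) : ℂ) ^ (n : ℕ) *
      ∑ z : Fin A × Fin B, scaledTaylorCoeff m X n z.1 z.2 * t z‖ ≤ N * ε := by
    refine (norm_sum_le_of_le _ (f := _) (n := fun _ => ε) fun n _ => ?_).trans_eq (by simp)
    rw [norm_mul, norm_pow, norm_real, Real.norm_eq_abs, abs_div, abs_of_nonneg (zero_le_one.trans hX)]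
    refine (mul_le_of_le_one_left (norm_nonneg _) (pow_le_one₀ (by positivity) ?_)).trans (hε n)
    exact div_le_one_of_le₀ hx (by positivity)
  rw [key] at h1
  refine (norm_le_norm_add_norm_sub _ _).trans (add_le_add h1 ?_)
  rw [norm_sub_rev, ← Finset.sum_sub_distrib]
  refine (norm_sum_le_of_le _ (f := _) (n := fun _ => H * (m * X) ^ A *
    Real.exp (3 * (2 * Real.pi * B * X) - M)) fun z _ => ?_).trans_eq (by simp)
  have hH : 0 ≤ H := (abs_nonneg _).trans (ht z)
  rw [← mul_sub, norm_mul, norm_mul, norm_pow, norm_real, norm_intCast, Real.norm_eq_abs, abs_mul,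
    Nat.abs_cast]
  have hW : ‖2 * Real.pi * I * (z.2 : ℕ) * x‖ ≤ 2 * Real.pi * B * X := by
    simp only [norm_mul, norm_natCast, norm_real, norm_I, RCLike.norm_ofNat, Real.norm_eq_abs,
      abs_of_pos Real.pi_pos, mul_one]
    have : ((z.2 : ℕ) : ℝ) ≤ B := by exact_mod_cast z.2.2.le
    gcongr
  refine mul_le_mul (mul_le_mul (ht z) ?_ (by positivity) hH)
    ((Complex.norm_exp_sub_sum_le_exp hW _).trans (Real.exp_le_exp.2 ?_)) (norm_nonneg _) (by positivity)
  · calc (m * |x|) ^ (z.1 : ℕ) ≤ (m * X) ^ (z.1 : ℕ) := by gcongr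
      _ ≤ _ := pow_le_pow_right₀ (one_le_mul_of_one_le_of_one_le hm' hX) z.1.2.le
  · rw [Nat.cast_sub (z.1.2.le.trans hAN)]
    have : ((z.1 : ℕ) : ℝ) ≤ A := by exact_mod_cast z.1.2.le
    linarith

open NumberField Complex in
theorem exists_exp_neg_le_abs_linearForm (k : Type*) [Field k] [NumberField k] {δ : k}
    (hδ : Function.Injective fun n : ℕ => δ ^ n) (σ : k →+* ℂ) {θ : ℝ} (hθ : σ δ = exp (I * θ)) :
    ∃ c : ℕ, ∀ (m : ℕ) (κ : ℤ) (A B R S N : ℕ), IsCoprime κ (m : ℤ) → |κ| ≤ m → 3 ≤ m →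
      0 < A → 0 < B → A * B ≤ m → B + R + S ≤ m → A * B ≤ R * S → 0 < N →
      2 * N * (Module.finrank ℚ k + 2 + 1) ≤ A * B →
      c * (A * Real.log m + B * (B + R + S)) + A ≤ N →
      Real.exp (-(c * (A * Real.log m + B * (B + R + S)))) ≤ |m * θ - 2 * Real.pi * κ| := by
  obtain ⟨q, hq1, hq⟩ := exists_one_le_norm_sum_mul_pow k δ
  obtain ⟨c₁, hc₁⟩ : ∃ c₁ : ℕ, q ≤ Real.exp c₁ :=
    ⟨⌈q⌉₊, (Nat.le_ceil q).trans (by linarith [Real.add_one_le_exp (⌈q⌉₊ : ℝ)])⟩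
  set D := Module.finrank ℚ k with hD
  set h : ℕ := D * (3 + c₁) + 17 with hh
  set s₀ : ℕ := D * (3 + h + c₁) with hs₀
  refine ⟨s₀ + h + 26, ?_⟩
  set c : ℕ := s₀ + h + 26 with hc
  intro m κ A B R S N hcop hκ hm hA hB hABm hXm hABRS hN hNAB hcN
  by_contra! hlam
  set Z : ℝ := A * Real.log m + B * (B + R + S) with hZ
  set X : ℝ := B + R + S with hX
  have hm0 : (0 : ℝ) < m := by positivity
  have hAr : (1 : ℝ) ≤ A := by exact_mod_cast hA
  have hBr : (1 : ℝ) ≤ B := by exact_mod_cast hB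
  have hX1 : 1 ≤ X := by
    have : (0 : ℝ) ≤ R + S := by positivity
    linarith
  have hlog : 0 ≤ Real.log m := Real.log_nonneg (by exact_mod_cast (by omega : 1 ≤ m))
  have hBX : B * X ≤ Z := le_add_of_nonneg_left (by positivity)
  have hAlog : A * Real.log m ≤ Z := le_add_of_nonneg_right (by positivity)
  have hZ1 : 1 ≤ Z := (one_le_mul_of_one_le_of_one_le hBr hX1).trans hBX
  have hZ0 : 0 ≤ Z := by linarith
  have hexpZ : Z ≤ Real.exp Z := by linarith [Real.add_one_le_exp Z]
  have htwo : 2 ≤ Real.exp Z := by linarith [Real.add_one_le_exp Z]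
  have hthree : 3 < Real.exp (2 * Z) := by
    rw [two_mul, Real.exp_add]; nlinarith
  have hmZ : (m : ℝ) ≤ Real.exp Z := by
    rw [← Real.exp_log hm0]
    exact Real.exp_le_exp.2 ((le_mul_of_one_le_left hlog hAr).trans hAlog)
  have hL : ((A * B : ℕ) : ℝ) ≤ Real.exp Z := (by exact_mod_cast hABm : ((A * B : ℕ) : ℝ) ≤ m).trans hmZ
  have hNL : (N : ℝ) ≤ Real.exp Z := by
    refine le_trans ?_ hL
    exact_mod_cast (by nlinarith : N ≤ A * B)
  have hXm' : X ≤ m := by rw [hX]; exact_mod_cast hXm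
  have hmX : (m * X) ^ A ≤ Real.exp (2 * Z) := by
    calc (m * X) ^ A ≤ ((m : ℝ) * m) ^ A := by gcongr
      _ = Real.exp (2 * (A * Real.log m)) := by
        rw [two_mul, Real.exp_add, Real.exp_nat_mul, Real.exp_log hm0, mul_pow]
      _ ≤ _ := Real.exp_le_exp.2 (by linarith)
  have hW : 2 * Real.pi * B * X ≤ 7 * Z := by
    have := Real.pi_lt_d2
    calc _ = 2 * Real.pi * (B * X) := by ring
      _ ≤ 7 * Z := by gcongr; linarith
  obtain ⟨Q, hQ0, hQ1, hQ2⟩ : ∃ Q : ℕ, 0 < Q ∧ Real.exp ((s₀ + h + 5) * Z) ≤ Q ∧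
      (Q : ℝ) ≤ Real.exp ((s₀ + h + 6) * Z) := by
    refine ⟨⌈Real.exp ((s₀ + h + 5) * Z)⌉₊, Nat.ceil_pos.2 (Real.exp_pos _), Nat.le_ceil _, ?_⟩
    have h1 := Nat.ceil_lt_add_one (Real.exp_pos ((s₀ + h + 5) * Z)).le
    have h2 : 1 ≤ Real.exp ((s₀ + h + 5) * Z) := Real.one_le_exp (by positivity)
    rw [show ((s₀ + h + 6 : ℝ) * Z) = (s₀ + h + 5) * Z + Z by ring, Real.exp_add]
    nlinarith
  have hcardβ : Fintype.card (Fin A × Fin B) = A * B := by simp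
  obtain ⟨t, ht0, htH, htε⟩ := exists_int_vec_norm_sum_le (β := Fin A × Fin B) (K := D + 2) hN (by omega)
    (fun n z => scaledTaylorCoeff m X n z.1 z.2) (G := Real.exp (9 * Z)) (H := Real.exp (h * Z))
    (Real.one_le_exp (by positivity))
    (fun n z => (norm_scaledTaylorCoeff_le (by omega) hX1 z.1.2.le z.2.2.le).trans (by
      rw [show 9 * Z = 2 * Z + 7 * Z by ring, Real.exp_add]
      gcongr)) (by rw [hcardβ]; exact hNAB) hQ0 (Real.exp_pos _).le (by
      rw [hcardβ]
      calc _ ≤ Real.exp Z * Real.exp Z * Real.exp ((s₀ + h + 6) * Z) * Real.exp (9 * Z) := by gcongr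
        _ = Real.exp (((D + 2 : ℕ) : ℝ) * (h * Z)) := by
          rw [← Real.exp_add, ← Real.exp_add, ← Real.exp_add, hs₀, hh]
          congr 1; push_cast; ring
        _ = _ := Real.exp_nat_mul _ _)
  rw [hcardβ] at htε
  have hvan : ∀ r < B + R, ∀ s < S,
      ∑ z : Fin A × Fin B, ((t z * (r * κ + s * m) ^ (z.1 : ℕ) : ℤ) : k) * δ ^ (r * (z.2 : ℕ)) = 0 := by
    intro r hr s hs
    by_contra hne
    set x : ℝ := r * κ / m + s with hx
    have hmx : (m : ℝ) * x = ((r * κ + s * m : ℤ) : ℝ) := by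
      rw [hx]; push_cast; field_simp
    have hrX : (r : ℝ) + s ≤ X := by
      rw [hX]; exact_mod_cast (by omega : r + s ≤ B + R + S)
    have hxX : |x| ≤ X := by
      refine le_trans ?_ hrX
      refine (abs_add_le _ _).trans (add_le_add ?_ (by simp))
      rw [abs_div, abs_mul, Nat.abs_cast, Nat.abs_cast]
      refine div_le_of_le_mul₀ hm0.le (by positivity) ?_
      gcongr
      exact_mod_cast hκ
    have hF := norm_sum_mul_pow_mul_exp_le (M := c * Z) (by omega) hX1 hxX hcN
      (by have : (A : ℝ) ≤ N := by nlinarith [show (0 : ℝ) ≤ c * Z by positivity]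
          exact_mod_cast this) htH htε
    have hrb : ∀ b : Fin B, ((r : ℝ) * (b : ℕ)) ≤ Z := fun b => by
      have : ((b : ℕ) : ℝ) ≤ B := by exact_mod_cast b.2.le
      have h2 : (r : ℝ) ≤ X := le_trans (by simp) hrX
      calc _ ≤ X * B := by gcongr
        _ ≤ Z := by linarith
    have hexp : ∀ b : Fin B, ‖exp (2 * Real.pi * I * (b : ℕ) * x) - (σ δ) ^ (r * (b : ℕ))‖ ≤
        Z * Real.exp (-(c * Z)) := by
      intro b
      rw [hθ, ← Complex.exp_nat_mul]
      have h1 : exp (2 * Real.pi * I * (b : ℕ) * x) =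
          exp (I * ((2 * Real.pi * r * (b : ℕ) * κ / m : ℝ) : ℂ)) := by
        have : (2 * Real.pi * I * (b : ℕ) * x : ℂ) =
            I * ((2 * Real.pi * r * (b : ℕ) * κ / m : ℝ) : ℂ) + ((b * s : ℕ) : ℂ) * (2 * Real.pi * I) := by
          rw [hx]; push_cast; ring
        rw [this, Complex.exp_add, Complex.exp_nat_mul_two_pi_mul_I, mul_one]
      have h2 : (((r * (b : ℕ) : ℕ) : ℂ) * (I * θ)) = I * ((2 * Real.pi * r * (b : ℕ) * κ / m : ℝ) : ℂ) +
          I * ((r * (b : ℕ) * ((m * θ - 2 * Real.pi * κ) / m) : ℝ) : ℂ) := by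
        have : (m : ℂ) ≠ 0 := by exact_mod_cast hm0.ne'
        push_cast; field_simp; ring
      rw [h1, h2, Complex.exp_add, ← mul_one_sub, norm_mul, mul_comm I, Complex.norm_exp_ofReal_mul_I,
        one_mul, norm_sub_rev]
      refine (Real.norm_exp_I_mul_ofReal_sub_one_le).trans ?_
      rw [Real.norm_eq_abs, abs_mul, abs_of_nonneg (by positivity : (0 : ℝ) ≤ r * (b : ℕ)), abs_div, Nat.abs_cast]
      refine mul_le_mul (hrb b) ((div_le_self (abs_nonneg _) ?_).trans hlam.le) (by positivity) hZ0
      exact_mod_cast (by omega : 1 ≤ m)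
    have hterm : ∀ z : Fin A × Fin B, |(t z : ℝ)| * |(m : ℝ) * x| ^ (z.1 : ℕ) ≤
        Real.exp ((h + 2) * Z) := fun z => by
      rw [show ((h + 2 : ℝ) * Z) = h * Z + 2 * Z by ring, Real.exp_add]
      refine mul_le_mul (htH z) (le_trans ?_ hmX) (by positivity) (Real.exp_pos _).le
      have hm1 : (1 : ℝ) ≤ m := by exact_mod_cast (by omega : 1 ≤ m)
      calc |(m : ℝ) * x| ^ (z.1 : ℕ) ≤ (m * X) ^ (z.1 : ℕ) := by
            rw [abs_mul, Nat.abs_cast]; gcongr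
        _ ≤ _ := pow_le_pow_right₀ (one_le_mul_of_one_le_of_one_le hm1 hX1) z.1.2.le
    set ξ := ∑ z : Fin A × Fin B, ((t z * (r * κ + s * m) ^ (z.1 : ℕ) : ℤ) : k) * δ ^ (r * (z.2 : ℕ)) with hξ
    have hσξ : σ ξ = ∑ z : Fin A × Fin B, t z * ((m * x : ℝ) : ℂ) ^ (z.1 : ℕ) * (σ δ) ^ (r * (z.2 : ℕ)) := by
      rw [hξ, map_sum]
      refine Finset.sum_congr rfl fun z _ => ?_
      rw [map_mul, map_pow, map_intCast, hmx]
      push_cast; ring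
    have hdiff : ‖(∑ z : Fin A × Fin B, t z * ((m * x : ℝ) : ℂ) ^ (z.1 : ℕ) *
        exp (2 * Real.pi * I * (z.2 : ℕ) * x)) - σ ξ‖ ≤
        (A * B : ℕ) * (Real.exp ((h + 2) * Z) * (Z * Real.exp (-(c * Z)))) := by
      rw [hσξ, ← Finset.sum_sub_distrib]
      refine (norm_sum_le_of_le _ (f := _) (n := fun _ => Real.exp ((h + 2) * Z) *
        (Z * Real.exp (-(c * Z)))) fun z _ => ?_).trans_eq (by simp)
      rw [← mul_sub, norm_mul, norm_mul, norm_pow, norm_real, norm_intCast, Real.norm_eq_abs]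
      exact mul_le_mul (hterm z) (hexp _) (norm_nonneg _) (Real.exp_pos _).le
    have hliou := hq σ Finset.univ (fun z : Fin A × Fin B => t z * (r * κ + s * m) ^ (z.1 : ℕ))
      (fun z => r * (z.2 : ℕ)) (B * (B + R + S)) (Real.exp ((3 + h) * Z))
      (fun z _ => by
        have : (z.2 : ℕ) ≤ B := z.2.2.le
        calc r * (z.2 : ℕ) ≤ (B + R + S) * B := by gcongr; omega
          _ = _ := mul_comm _ _) (Real.one_le_exp (by positivity))
      (by
        calc _ ≤ ∑ z : Fin A × Fin B, Real.exp ((h + 2) * Z) := by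
              refine Finset.sum_le_sum fun z _ => ?_
              refine le_trans (le_of_eq ?_) (hterm z)
              rw [hmx, ← abs_pow, ← abs_mul]
              push_cast; rfl
          _ = (A * B : ℕ) * Real.exp ((h + 2) * Z) := by simp
          _ ≤ Real.exp Z * Real.exp ((h + 2) * Z) := by gcongr
          _ = _ := by rw [← Real.exp_add]; congr 1; ring) hne
    have hqE : (Real.exp ((3 + h) * Z) * q ^ (B * (B + R + S))) ^ D ≤ Real.exp (s₀ * Z) := by
      have hqE' : q ^ (B * (B + R + S)) ≤ Real.exp (c₁ * Z) := by
        calc q ^ (B * (B + R + S)) ≤ Real.exp c₁ ^ (B * (B + R + S)) := by gcongr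
          _ = Real.exp (c₁ * (B * X)) := by
            rw [← Real.exp_nat_mul, hX]; push_cast; congr 1; ring
          _ ≤ _ := by gcongr
      calc _ ≤ (Real.exp ((3 + h) * Z) * Real.exp (c₁ * Z)) ^ D := by gcongr
        _ = _ := by
          rw [← Real.exp_add, ← Real.exp_nat_mul, hs₀]; congr 1; push_cast; ring
    have hsmall : ‖σ ξ‖ ≤ 3 * Real.exp (-((s₀ + 2) * Z)) := by
      have h1 : N * (2 * (A * B : ℕ) * Real.exp (h * Z) / Q) ≤ Real.exp (-((s₀ + 2) * Z)) := by
        rw [← mul_div_assoc, div_le_iff₀ (by exact_mod_cast hQ0)]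
        calc _ ≤ Real.exp Z * (Real.exp Z * Real.exp Z * Real.exp (h * Z)) := by gcongr
          _ = Real.exp (-((s₀ + 2) * Z)) * Real.exp ((s₀ + h + 5) * Z) := by
            simp only [← Real.exp_add]; congr 1; ring
          _ ≤ _ := by gcongr
      have h2 : (A * B : ℕ) * (Real.exp (h * Z) * (m * X) ^ A *
          Real.exp (3 * (2 * Real.pi * B * X) - c * Z)) ≤ Real.exp (-((s₀ + 2) * Z)) := by
        calc _ ≤ Real.exp Z * (Real.exp (h * Z) * Real.exp (2 * Z) * Real.exp (3 * (7 * Z) - c * Z)) := by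
              gcongr
          _ = _ := by
            simp only [← Real.exp_add]; rw [hc]; congr 1; push_cast; ring
      have h3 : (A * B : ℕ) * (Real.exp ((h + 2) * Z) * (Z * Real.exp (-(c * Z)))) ≤
          Real.exp (-((s₀ + 2) * Z)) := by
        calc _ ≤ Real.exp Z * (Real.exp ((h + 2) * Z) * (Real.exp Z * Real.exp (-(c * Z)))) := by gcongr
          _ = Real.exp (-(s₀ + 22) * Z) := by
            simp only [← Real.exp_add]; rw [hc]; congr 1; push_cast; ring
          _ ≤ _ := Real.exp_le_exp.2 (by linarith)
      have h4 := norm_le_norm_add_norm_sub (∑ z : Fin A × Fin B, t z * ((m * x : ℝ) : ℂ) ^ (z.1 : ℕ) *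
        exp (2 * Real.pi * I * (z.2 : ℕ) * x)) (σ ξ)
      linarith
    have : ‖σ ξ‖ * (Real.exp ((3 + h) * Z) * q ^ (B * (B + R + S))) ^ D < 1 := by
      calc _ ≤ 3 * Real.exp (-((s₀ + 2) * Z)) * Real.exp (s₀ * Z) := by gcongr
        _ = 3 * Real.exp (-(2 * Z)) := by
          rw [mul_assoc, ← Real.exp_add]; congr 2; ring
        _ < Real.exp (2 * Z) * Real.exp (-(2 * Z)) := by gcongr
        _ = 1 := by rw [← Real.exp_add, add_neg_cancel, Real.exp_zero]
    exact absurd hliou (not_le.2 this)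
  classical
  let P : Fin B → Polynomial k := fun b =>
    ∑ a : Fin A, Polynomial.C (t (a, b) : k) * Polynomial.X ^ (a : ℕ)
  let J : Finset (Fin B) := Finset.univ.filter fun b => P b ≠ 0
  have hJ : 0 < J.card := by
    rw [Finset.card_pos]
    by_contra hJ
    rw [Finset.not_nonempty_iff_eq_empty, Finset.filter_eq_empty_iff] at hJ
    refine ht0 (funext fun ⟨a, b⟩ => ?_)
    have h1 := congrArg (fun p => Polynomial.coeff p a) (not_not.1 (hJ (Finset.mem_univ b)))
    simpa [P, Polynomial.finsetSum_coeff, Polynomial.coeff_X_pow, Fin.val_inj] using h1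
  have hJB : J.card ≤ B := (Finset.card_le_univ J).trans_eq (Fintype.card_fin B)
  obtain ⟨r, hr, s, hs, hne⟩ := exists_eval_add_mul_pow_ne_zero hδ hJ
    (e := fun i => ((J.equivFin.symm i : Fin B) : ℕ))
    (Fin.val_injective.comp (Subtype.val_injective.comp J.equivFin.symm.injective))
    (P := fun i => P (J.equivFin.symm i)) (fun i => (Finset.mem_filter.1 (J.equivFin.symm i).2).2)
    (d := A - 1) (fun i => Polynomial.natDegree_sum_le_of_forall_le _ _ fun a _ =>
      (Polynomial.natDegree_C_mul_X_pow_le _ _).trans (by omega))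
    (R := R) (S := S) hcop (by omega) (by omega) (by
      calc J.card * (A - 1) ≤ B * (A - 1) := by gcongr
        _ < B * A := by gcongr; omega
        _ ≤ R * S := by rwa [mul_comm])
  refine hne ?_
  rw [J.equivFin.symm.sum_comp (fun b : J => (P b).eval ((r * κ + s * m : ℤ) : k) * δ ^ (r * ((b : Fin B) : ℕ))),
    Finset.sum_coe_sort J (fun b => (P b).eval ((r * κ + s * m : ℤ) : k) * δ ^ (r * (b : ℕ))),
    Finset.sum_filter_of_ne (p := fun b => P b ≠ 0) (fun b _ hb hP => hb (by rw [hP]; simp)),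
    ← hvan r (by omega) s hs,
    Fintype.sum_prod_type_right]
  refine Finset.sum_congr rfl fun b _ => ?_
  simp only [P, Polynomial.eval_finsetSum, Finset.sum_mul]
  refine Finset.sum_congr rfl fun a _ => ?_
  simp

theorem exists_exp_neg_sq_log_le_abs_linearForm (k : Type*) [Field k] [NumberField k] {δ : k}
    (hδ : Function.Injective fun n : ℕ => δ ^ n) (σ : k →+* ℂ) {θ : ℝ}
    (hθ : σ δ = Complex.exp (Complex.I * θ)) :
    ∃ C : ℝ, 0 ≤ C ∧ ∀ᶠ m : ℕ in Filter.atTop, ∀ κ : ℤ, IsCoprime κ (m : ℤ) → |κ| ≤ m →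
      Real.exp (-(C * Real.log m ^ 2)) ≤ |m * θ - 2 * Real.pi * κ| := by
  obtain ⟨c, hc⟩ := exists_exp_neg_le_abs_linearForm k hδ σ hθ
  set D := Module.finrank ℚ k
  set r : ℕ := 2 * (4 * c + 1) * (D + 2 + 1) with hr
  set n : ℕ := (4 * c + 1) * r with hn
  have hr1 : 1 ≤ r := Nat.one_le_iff_ne_zero.2 (by positivity)
  refine ⟨n * (4 * r ^ 4), by positivity, ?_⟩
  have hlarge : ∀ᶠ m : ℕ in Filter.atTop, 4 * (r : ℝ) ^ 2 * (2 * r ^ 2 * Real.log m) ^ 2 ≤ m := by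
    have h1 := ((Real.isLittleO_pow_log_id_atTop (n := 2)).comp_tendsto
      tendsto_natCast_atTop_atTop).bound (c := (4 * (r : ℝ) ^ 2 * (2 * r ^ 2) ^ 2)⁻¹) (by positivity)
    filter_upwards [h1] with m hm
    simp only [Function.comp_apply, id, norm_pow, Real.norm_eq_abs, sq_abs, Nat.abs_cast] at hm
    rw [inv_mul_eq_div, le_div_iff₀ (by positivity)] at hm
    linarith
  filter_upwards [hlarge, Filter.eventually_ge_atTop 3] with m hm hm3 κ hcop hκ
  have hlog1 : 1 ≤ Real.log m := by
    rw [Real.le_log_iff_exp_le (by positivity)]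
    have : (3 : ℝ) ≤ m := by exact_mod_cast hm3
    linarith [Real.exp_one_lt_three]
  set T : ℕ := ⌈(r : ℝ) ^ 2 * Real.log m⌉₊ with hT
  have hr1' : (1 : ℝ) ≤ r := by exact_mod_cast hr1
  have hTlog : (r : ℝ) ^ 2 * Real.log m ≤ T := Nat.le_ceil _
  have hrT : r ^ 2 ≤ T := by
    have : (r : ℝ) ^ 2 ≤ T := le_trans (by nlinarith) hTlog
    exact_mod_cast this
  have hT1 : 1 ≤ T := le_trans (Nat.one_le_pow _ _ hr1) hrT
  have hTle : (T : ℝ) ≤ 2 * r ^ 2 * Real.log m := by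
    have := Nat.ceil_lt_add_one (a := (r : ℝ) ^ 2 * Real.log m) (by positivity)
    have : 1 ≤ (r : ℝ) ^ 2 * Real.log m := one_le_mul_of_one_le_of_one_le (one_le_pow₀ hr1') hlog1
    linarith
  have hTm : 4 * r ^ 2 * T ^ 2 ≤ m := by
    have : 4 * (r : ℝ) ^ 2 * (T : ℝ) ^ 2 ≤ m := le_trans (by gcongr) hm
    exact_mod_cast this
  have hTT : T ≤ T ^ 2 := Nat.le_self_pow two_ne_zero T
  have hrr : r ≤ r ^ 2 := Nat.le_self_pow two_ne_zero r
  have hN : (c : ℝ) * (((r ^ 2 * T : ℕ) : ℝ) * Real.log m + (T : ℝ) * (T + (r * T : ℕ) + (r * T : ℕ))) +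
      (r ^ 2 * T : ℕ) ≤ (n * T ^ 2 : ℕ) := by
    have h1 : ((r ^ 2 * T : ℕ) : ℝ) * Real.log m ≤ T ^ 2 := by
      push_cast
      nlinarith
    have h2 : ((r ^ 2 * T : ℕ) : ℝ) ≤ T ^ 2 := by
      exact_mod_cast (by nlinarith : r ^ 2 * T ≤ T ^ 2)
    calc _ ≤ (c : ℝ) * (T ^ 2 + (T : ℝ) * (T + (r * T : ℕ) + (r * T : ℕ))) + T ^ 2 := by gcongr
      _ = (c * (2 + 2 * r) + 1) * (T : ℝ) ^ 2 := by push_cast; ring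
      _ ≤ ((4 * c + 1) * r) * (T : ℝ) ^ 2 := by
        gcongr
        nlinarith [show (0 : ℝ) ≤ c by positivity]
      _ = _ := by rw [hn]; push_cast; ring
  have key := hc m κ (r ^ 2 * T) T (r * T) (r * T) (n * T ^ 2) hcop hκ hm3 (by positivity) hT1
    (by nlinarith) (by nlinarith) (by ring_nf; rfl) (by positivity)
    (by rw [hn]; apply le_of_eq; rw [show r ^ 2 = r * r by ring]; nth_rw 2 [hr]; ring) hN
  refine le_trans (Real.exp_le_exp.2 (neg_le_neg ?_)) key
  calc _ ≤ ((n * T ^ 2 : ℕ) : ℝ) := le_trans (le_add_of_nonneg_right (by positivity)) hN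
    _ ≤ n * (2 * r ^ 2 * Real.log m) ^ 2 := by push_cast; gcongr
    _ = _ := by ring

theorem exists_exp_neg_le_abs_nat_mul_sub (k : Type*) [Field k] [NumberField k] {δ : k}
    (hδ : Function.Injective fun n : ℕ => δ ^ n) (σ : k →+* ℂ) {θ : ℝ}
    (hθ : σ δ = Complex.exp (Complex.I * θ)) :
    ∃ C : ℝ, 0 ≤ C ∧ ∀ m : ℕ, 0 < m → ∀ κ : ℤ, |κ| ≤ m →
      Real.exp (-(C * (1 + Real.log m) ^ 2)) ≤ |m * θ - 2 * Real.pi * κ| := by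
  obtain ⟨C₀, hC₀, h⟩ := exists_exp_neg_sq_log_le_abs_linearForm k hδ σ hθ
  obtain ⟨m₀, hm₀⟩ := Filter.eventually_atTop.1 h
  have hne : ∀ m : ℕ, 0 < m → ∀ κ : ℤ, (m * θ - 2 * Real.pi * κ) ≠ 0 := by
    intro m hm κ h0
    have h1 : σ δ ^ m = 1 := by
      rw [hθ, ← Complex.exp_nat_mul, Complex.exp_eq_one_iff]
      refine ⟨κ, ?_⟩
      have : (m * θ : ℂ) = 2 * Real.pi * κ := by exact_mod_cast sub_eq_zero.1 h0
      linear_combination Complex.I * this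
    have := @hδ m 0 (σ.injective (by simpa using h1))
    omega
  let F : ℕ × ℤ → ℝ := fun z => |Real.log (|z.1 * θ - 2 * Real.pi * z.2|)|
  let I : Finset (ℕ × ℤ) := Finset.range m₀ ×ˢ Finset.Icc (-m₀ : ℤ) m₀
  have hF0 : 0 ≤ ∑ z ∈ I, F z := Finset.sum_nonneg fun _ _ => abs_nonneg _
  have hcop : ∀ m : ℕ, 0 < m → ∀ κ : ℤ, IsCoprime κ (m : ℤ) → |κ| ≤ m →
      Real.exp (-((C₀ + ∑ z ∈ I, F z) * (1 + Real.log m) ^ 2)) ≤ |m * θ - 2 * Real.pi * κ| := by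
    intro m hm κ hcop hκ
    have hlog : 0 ≤ Real.log m := Real.log_natCast_nonneg m
    rcases le_or_gt m₀ m with h | h
    · refine le_trans (Real.exp_le_exp.2 (neg_le_neg ?_)) (hm₀ m h κ hcop hκ)
      gcongr
      · linarith
      · linarith
    · have hz : (m, κ) ∈ I := by
        rw [abs_le] at hκ
        simp only [I, Finset.mem_product, Finset.mem_range, Finset.mem_Icc]
        omega
      have h1 : F (m, κ) ≤ ∑ z ∈ I, F z :=
        Finset.single_le_sum (f := F) (fun _ _ => abs_nonneg _) hz
      rw [← Real.le_log_iff_exp_le (abs_pos.2 (hne m hm κ))]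
      refine le_trans (neg_le_neg ?_) (neg_abs_le _)
      calc F (m, κ) ≤ (C₀ + ∑ z ∈ I, F z) * 1 := by linarith
        _ ≤ _ := by
          gcongr
          exact one_le_pow₀ (by linarith)
  refine ⟨C₀ + ∑ z ∈ I, F z, by positivity, fun m hm κ hκ => ?_⟩
  have hg : 0 < Int.gcd κ m := Int.gcd_pos_of_ne_zero_right _ (by exact_mod_cast hm.ne')
  obtain ⟨κ', hκ'⟩ := Int.gcd_dvd_left κ m
  obtain ⟨m', hm'⟩ : Int.gcd κ m ∣ m := by exact_mod_cast Int.gcd_dvd_right κ m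
  set g := Int.gcd κ m with hgdef
  have hm'0 : 0 < m' := Nat.pos_of_ne_zero fun h => by simp [h] at hm'; omega
  have hcop' : IsCoprime κ' (m' : ℤ) := by
    rw [Int.isCoprime_iff_gcd_eq_one]
    have h1 : g * Int.gcd κ' m' = g := by
      conv_rhs => rw [hgdef, hκ', hm']
      push_cast
      rw [Int.gcd_mul_left]; simp
    exact Nat.eq_of_mul_eq_mul_left hg (by rw [h1, mul_one])
  have hκm : |κ'| ≤ m' := by
    rw [hκ', hm', abs_mul, Nat.abs_cast] at hκ
    push_cast at hκ
    exact le_of_mul_le_mul_left hκ (by exact_mod_cast hg)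
  have hg1 : (1 : ℝ) ≤ g := by exact_mod_cast hg
  have hm'm : (m' : ℝ) ≤ m := by
    exact_mod_cast Nat.le_of_dvd hm (Dvd.intro_left _ hm'.symm)
  have hlog : 0 ≤ Real.log m' := Real.log_natCast_nonneg m'
  calc _ ≤ Real.exp (-((C₀ + ∑ z ∈ I, F z) * (1 + Real.log m') ^ 2)) := by gcongr
    _ ≤ |m' * θ - 2 * Real.pi * κ'| := hcop m' hm'0 κ' hcop' hκm
    _ ≤ g * |m' * θ - 2 * Real.pi * κ'| := le_mul_of_one_le_left (abs_nonneg _) hg1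
    _ = |m * θ - 2 * Real.pi * κ| := by
      have h1 : (m : ℝ) = g * m' := by exact_mod_cast hm'
      have h2 : (κ : ℝ) = g * κ' := by exact_mod_cast hκ'
      rw [h1, h2, ← Nat.abs_cast, ← abs_mul, Nat.abs_cast]; congr 1; ring

theorem exists_exp_neg_le_norm_pow_sub_one (k : Type*) [Field k] [NumberField k] {δ : k}
    (hδ : Function.Injective fun n : ℕ => δ ^ n) (σ : k →+* ℂ) (hσ : ‖σ δ‖ = 1) :
    ∃ C : ℝ, 0 ≤ C ∧ ∀ m : ℕ, 0 < m → Real.exp (-(C * (1 + Real.log m) ^ 2)) ≤ ‖σ δ ^ m - 1‖ := by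
  set θ := (σ δ).arg with hθdef
  have hθ : σ δ = Complex.exp (Complex.I * θ) := by
    have := Complex.norm_mul_exp_arg_mul_I (σ δ)
    rw [hσ, Complex.ofReal_one, one_mul] at this
    rw [mul_comm, hθdef, this]
  obtain ⟨C, hC0, hC⟩ := exists_exp_neg_le_abs_nat_mul_sub k hδ σ hθ
  refine ⟨C + 1, by positivity, fun m hm => ?_⟩
  have hpi := Real.pi_pos
  have hm1 : (1 : ℝ) ≤ m := by exact_mod_cast hm
  set κ : ℤ := round (m * θ / (2 * Real.pi)) with hκ
  have hround : |m * θ / (2 * Real.pi) - κ| ≤ 1 / 2 := abs_sub_round _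
  have hlam : m * θ - 2 * Real.pi * κ = 2 * Real.pi * (m * θ / (2 * Real.pi) - κ) := by
    field_simp
  have hlampi : |(m * θ - 2 * Real.pi * κ) / 2| ≤ Real.pi / 2 := by
    rw [hlam, abs_div, abs_mul, abs_of_pos (by positivity : 0 < 2 * Real.pi), abs_two]
    nlinarith
  have hκm : |κ| ≤ m := by
    have h1 : |m * θ / (2 * Real.pi)| ≤ m / 2 := by
      rw [abs_div, abs_mul, Nat.abs_cast, abs_of_pos (by positivity : 0 < 2 * Real.pi),
        div_le_div_iff₀ (by positivity) (by positivity)]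
      have := Complex.abs_arg_le_pi (σ δ)
      nlinarith [mul_le_mul_of_nonneg_left this (by positivity : (0 : ℝ) ≤ m)]
    have h2 : |(κ : ℝ)| ≤ m := by
      rw [abs_le] at h1 hround ⊢
      constructor <;> linarith [h1.1, h1.2, hround.1, hround.2]
    exact_mod_cast h2
  have hpow : σ δ ^ m = Complex.exp (Complex.I * ((m * θ - 2 * Real.pi * κ : ℝ) : ℂ)) := by
    rw [hθ, ← Complex.exp_nat_mul, Complex.exp_eq_exp_iff_exists_int]
    exact ⟨κ, by push_cast; ring⟩
  rw [hpow, Complex.norm_exp_I_mul_ofReal_sub_one, norm_mul, Real.norm_eq_abs, Real.norm_eq_abs, abs_two]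
  have hsin := Real.mul_abs_le_abs_sin hlampi
  have hhalf : Real.exp (-1) ≤ 1 / 2 := by
    rw [Real.exp_neg, ← one_div]
    exact one_div_le_one_div_of_le (by norm_num) (by linarith [Real.add_one_le_exp 1])
  have hlog : 0 ≤ Real.log m := Real.log_natCast_nonneg m
  calc Real.exp (-((C + 1) * (1 + Real.log m) ^ 2))
      ≤ Real.exp (-1) * Real.exp (-(C * (1 + Real.log m) ^ 2)) := by
        rw [← Real.exp_add, Real.exp_le_exp]
        nlinarith
    _ ≤ 1 / 2 * |m * θ - 2 * Real.pi * κ| := by gcongr; exact hC m hm κ hκm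
    _ ≤ 2 * (2 / Real.pi * |(m * θ - 2 * Real.pi * κ) / 2|) := by
        rw [abs_div, abs_two]
        have : 1 / 2 ≤ 2 / Real.pi := by
          rw [div_le_div_iff₀ (by positivity) (by positivity)]
          linarith [Real.pi_le_four]
        nlinarith [abs_nonneg (m * θ - 2 * Real.pi * κ)]
    _ ≤ _ := by gcongr

theorem totient_mul_sub_le_of_sum_divisors {f g : ℕ → ℝ}
    (hfg : ∀ m > 0, ∑ d ∈ m.divisors, f d = g m) {m : ℕ} (hm : 0 < m) {L E : ℝ}
    (hE : ∀ d ∈ m.divisors, |g d - d * L| ≤ E) :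
    m.totient * L - m.divisors.card * E ≤ f m := by
  have h1 := (ArithmeticFunction.sum_eq_iff_sum_mul_moebius_eq (R := ℝ)).1 hfg m hm
  have h2 := (ArithmeticFunction.sum_eq_iff_sum_mul_moebius_eq (R := ℝ)
    (f := fun d => (d.totient : ℝ)) (g := fun d => (d : ℝ))).1
    (fun n _ => by exact_mod_cast Nat.sum_totient n) m hm
  have h3 : f m - m.totient * L =
      ∑ x ∈ m.divisorsAntidiagonal, (ArithmeticFunction.moebius x.1 : ℝ) * (g x.2 - x.2 * L) := by
    rw [← h1, ← h2, Finset.sum_mul, ← Finset.sum_sub_distrib]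
    exact Finset.sum_congr rfl fun x _ => by ring
  have h4 : |f m - m.totient * L| ≤ m.divisors.card * E := by
    rw [h3]
    refine (Finset.abs_sum_le_sum_abs _ _).trans ?_
    have : ∀ x ∈ m.divisorsAntidiagonal,
        |(ArithmeticFunction.moebius x.1 : ℝ) * (g x.2 - x.2 * L)| ≤ E := fun x hx => by
      rw [abs_mul]
      have h5 : |(ArithmeticFunction.moebius x.1 : ℝ)| ≤ 1 := by
        exact_mod_cast ArithmeticFunction.abs_moebius_le_one
      have h6 := hE x.2 (Nat.snd_mem_divisors_of_mem_antidiagonal hx)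
      calc _ ≤ 1 * E := by gcongr
        _ = E := one_mul E
    refine (Finset.sum_le_card_nsmul _ _ _ this).trans_eq ?_
    rw [nsmul_eq_mul, ← Nat.map_div_right_divisors, Finset.card_map]
  linarith [(abs_le.1 h4).1]

theorem exists_abs_log_norm_pow_sub_one_sub_le (k : Type*) [Field k] [NumberField k] {δ : k}
    (hδ : Function.Injective fun n : ℕ => δ ^ n) (σ : k →+* ℂ) :
    ∃ C : ℝ, 0 ≤ C ∧ ∀ d : ℕ, 0 < d →
      |Real.log ‖σ δ ^ d - 1‖ - d * Real.log (max ‖σ δ‖ 1)| ≤ C * (1 + Real.log d) ^ 2 := by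
  have hne : ∀ d : ℕ, 0 < d → 0 < ‖σ δ ^ d - 1‖ := fun d hd => by
    rw [norm_pos_iff, sub_ne_zero, ← map_pow]
    intro h
    have := @hδ d 0 (σ.injective (by simpa using h))
    omega
  set a := ‖σ δ‖ with ha
  set M := max a 1 with hM
  have hM1 : 1 ≤ M := le_max_right _ _
  have hM0 : 0 < M := by linarith
  have haM : a ≤ M := le_max_left _ _
  have ha0 : 0 ≤ a := norm_nonneg _
  have hupper : ∀ d : ℕ, ‖σ δ ^ d - 1‖ ≤ 2 * M ^ d := fun d => by
    refine (norm_sub_le _ _).trans ?_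
    rw [norm_pow, norm_one, ← ha]
    have := pow_le_pow_left₀ ha0 haM d
    have := one_le_pow₀ hM1 (n := d)
    linarith
  obtain ⟨C, hC0, hC⟩ : ∃ C : ℝ, 0 ≤ C ∧ ∀ d : ℕ, 0 < d →
      Real.exp (-(C * (1 + Real.log d) ^ 2)) * M ^ d ≤ ‖σ δ ^ d - 1‖ := by
    by_cases h1 : a = 1
    · obtain ⟨C, hC0, hC⟩ := exists_exp_neg_le_norm_pow_sub_one k hδ σ h1
      refine ⟨C, hC0, fun d hd => ?_⟩
      simpa [hM, h1] using hC d hd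
    · have hq : 0 < |a - 1| / M := div_pos (abs_pos.2 (sub_ne_zero.2 h1)) hM0
      refine ⟨|Real.log (|a - 1| / M)|, abs_nonneg _, fun d hd => ?_⟩
      have hlog : 0 ≤ Real.log d := Real.log_natCast_nonneg d
      have hexp : Real.exp (-(|Real.log (|a - 1| / M)| * (1 + Real.log d) ^ 2)) ≤ |a - 1| / M := by
        rw [← Real.le_log_iff_exp_le hq]
        refine le_trans (neg_le_neg ?_) (neg_abs_le _)
        exact le_mul_of_one_le_right (abs_nonneg _) (one_le_pow₀ (by linarith))
      have hnorm : |a ^ d - 1| ≤ ‖σ δ ^ d - 1‖ := by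
        have := abs_norm_sub_norm_le (σ δ ^ d) 1
        rwa [norm_pow, norm_one, ← ha] at this
      refine le_trans (mul_le_mul_of_nonneg_right hexp (by positivity)) (le_trans ?_ hnorm)
      obtain ⟨e, rfl⟩ := Nat.exists_eq_add_of_le' hd
      rw [pow_succ, div_mul_eq_mul_div, div_le_iff₀ hM0, ← mul_assoc]
      refine mul_le_mul_of_nonneg_right ?_ hM0.le
      rcases lt_or_gt_of_ne h1 with h | h
      · have : M = 1 := max_eq_right h.le
        rw [this, one_pow, mul_one, abs_of_neg (by linarith), abs_of_nonpos (by
          linarith [pow_le_one₀ ha0 h.le (n := e + 1)])]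
        have : a ^ (e + 1) ≤ a := by
          rw [pow_succ]; exact mul_le_of_le_one_left ha0 (pow_le_one₀ ha0 h.le)
        linarith
      · have : M = a := max_eq_left h.le
        have h2 := one_le_pow₀ h.le (n := e)
        rw [this, abs_of_pos (by linarith), abs_of_nonneg (by
          linarith [one_le_pow₀ h.le (n := e + 1)]), pow_succ]
        nlinarith
  refine ⟨C + 1, by positivity, fun d hd => ?_⟩
  have hlog : 0 ≤ Real.log d := Real.log_natCast_nonneg d
  have hone : 1 ≤ (1 + Real.log d) ^ 2 := one_le_pow₀ (by linarith)
  have h1 := Real.log_le_log (by positivity) (hC d hd)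
  have h2 := Real.log_le_log (hne d hd) (hupper d)
  rw [Real.log_mul (Real.exp_ne_zero _) (by positivity), Real.log_exp, Real.log_pow] at h1
  rw [Real.log_mul two_ne_zero (by positivity), Real.log_pow] at h2
  have h3 : Real.log 2 ≤ 1 := by linarith [Real.log_two_lt_d9]
  rw [abs_le]
  constructor <;> nlinarith

theorem exists_exp_neg_le_infinitePlace_eval_cyclotomic (k : Type*) [Field k] [NumberField k] {δ : k}
    (hδ : Function.Injective fun n : ℕ => δ ^ n) (w : NumberField.InfinitePlace k) :
    ∃ C : ℝ, 0 ≤ C ∧ ∀ m : ℕ, 0 < m →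
      max (w δ) 1 ^ m.totient * Real.exp (-(C * (m.divisors.card * (1 + Real.log m) ^ 2))) ≤
        w ((Polynomial.cyclotomic m k).eval δ) := by
  obtain ⟨C, hC0, hC⟩ := exists_abs_log_norm_pow_sub_one_sub_le k hδ w.embedding
  refine ⟨C, hC0, fun m hm => ?_⟩
  have hprod : ∀ d > 0, ∏ i ∈ d.divisors, (Polynomial.cyclotomic i k).eval δ = δ ^ d - 1 := by
    intro d hd
    rw [← Polynomial.eval_prod, Polynomial.prod_cyclotomic_eq_X_pow_sub_one hd]
    simp
  have hpow : ∀ d > 0, δ ^ d - 1 ≠ 0 := fun d hd h => by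
    have := @hδ d 0 (by simpa [sub_eq_zero] using h)
    omega
  have hne : ∀ d > 0, (Polynomial.cyclotomic d k).eval δ ≠ 0 := fun d hd h =>
    hpow d hd (by rw [← hprod d hd]; exact Finset.prod_eq_zero (Nat.mem_divisors_self d hd.ne') h)
  have key := totient_mul_sub_le_of_sum_divisors
    (f := fun d => Real.log (w ((Polynomial.cyclotomic d k).eval δ)))
    (g := fun d => Real.log ‖w.embedding δ ^ d - 1‖) (fun d hd => by
      rw [← Real.log_prod fun i hi => (w.pos_iff.2 (hne i (Nat.pos_of_mem_divisors hi))).ne',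
        ← map_prod, hprod d hd, ← w.norm_embedding_eq, map_sub, map_pow, map_one]) hm
    (L := Real.log (max ‖w.embedding δ‖ 1)) (E := C * (1 + Real.log m) ^ 2) (fun d hd => by
      have hd0 := Nat.pos_of_mem_divisors hd
      have hlog : 0 ≤ Real.log d := Real.log_natCast_nonneg d
      refine (hC d hd0).trans ?_
      have : (d : ℝ) ≤ m := by exact_mod_cast Nat.divisor_le hd
      gcongr)
  rw [w.norm_embedding_eq] at key
  have hmax : 0 < max (w δ) 1 := lt_max_of_lt_right one_pos
  rw [← Real.log_le_log_iff (by positivity) (w.pos_iff.2 (hne m hm)),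
    Real.log_mul (by positivity) (Real.exp_ne_zero _), Real.log_pow, Real.log_exp]
  linarith

namespace NumberField.FinitePlace

section

variable {k : Type*} [Field k] [NumberField k] (v : FinitePlace k)

theorem isNonarchimedean : IsNonarchimedean v := FinitePlace.add_le v

theorem apply_natCast_le_one (n : ℕ) : v n ≤ 1 := v.isNonarchimedean.apply_natCast_le_one

theorem apply_intCast_le_one (n : ℤ) : v n ≤ 1 := v.isNonarchimedean.apply_intCast_le_one

theorem apply_eq_one_of_coprime {a b : ℕ} (hab : a.Coprime b) (ha : v a < 1) : v b = 1 := by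
  refine (v.apply_natCast_le_one b).antisymm ?_
  by_contra! hb
  obtain ⟨c, d, hcd⟩ := Nat.isCoprime_iff_coprime.2 hab
  have h1 : (c : k) * a + d * b = 1 := by exact_mod_cast congrArg (Int.cast (R := k)) hcd
  have h2 : v (1 : k) < 1 := by
    rw [← h1]
    refine (FinitePlace.add_le v _ _).trans_lt (max_lt ?_ ?_)
    · rw [map_mul]
      exact mul_lt_one_of_nonneg_of_lt_one_right (v.apply_intCast_le_one c) (by positivity) ha
    · rw [map_mul]
      exact mul_lt_one_of_nonneg_of_lt_one_right (v.apply_intCast_le_one d) (by positivity) hb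
  simp at h2

theorem apply_le_one_of_mem_closure {s : Set k} (hs : ∀ x ∈ s, v x ≤ 1) {x : k}
    (hx : x ∈ Subring.closure s) : v x ≤ 1 := by
  induction hx using Subring.closure_induction with
  | mem x hx => exact hs x hx
  | zero => simp
  | one => simp
  | add x y _ _ hx hy => exact (FinitePlace.add_le v _ _).trans (max_le hx hy)
  | neg x _ hx => rwa [map_neg_eq_map]
  | mul x y _ _ hx hy => rw [map_mul]; exact mul_le_one₀ hx (by positivity) hy

theorem apply_aeval_le_one (p : Polynomial ℤ) {x : k} (hx : v x ≤ 1) :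
    v (Polynomial.aeval x p) ≤ 1 := by
  induction p using Polynomial.induction_on' with
  | add p q hp hq =>
    rw [map_add]
    exact (FinitePlace.add_le v _ _).trans (max_le hp hq)
  | monomial n a =>
    rw [Polynomial.aeval_monomial, map_mul, map_pow]
    exact mul_le_one₀ (by simpa using v.apply_intCast_le_one a) (by positivity) (pow_le_one₀ (by positivity) hx)

theorem apply_aeval_le_of_dvd {p q : Polynomial ℤ} (hpq : p ∣ q) {x : k} (hx : v x ≤ 1) :
    v (Polynomial.aeval x q) ≤ v (Polynomial.aeval x p) := by
  obtain ⟨r, rfl⟩ := hpq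
  rw [map_mul, map_mul]
  exact mul_le_of_le_one_right (by positivity) (v.apply_aeval_le_one r hx)

theorem apply_aeval_of_monic {p : Polynomial ℤ} (hp : p.Monic) {x : k} (hx : 1 < v x) :
    v (Polynomial.aeval x p) = v x ^ p.natDegree := by
  have hx0 : 0 < v x := by linarith
  set q : Polynomial ℤ := ∑ i ∈ Finset.range p.natDegree, Polynomial.C (p.coeff i) * Polynomial.X ^ i
  have hq : v (Polynomial.aeval x q) < v x ^ p.natDegree := by
    simp only [q, map_sum, map_mul, map_pow, Polynomial.aeval_C, Polynomial.aeval_X]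
    rcases Nat.eq_zero_or_pos p.natDegree with h0 | h0
    · simp [h0]
    · obtain ⟨i, hi, hle⟩ := v.isNonarchimedean.finset_image_add_of_nonempty
        (fun i => algebraMap ℤ k (p.coeff i) * x ^ i) (Finset.nonempty_range_iff.2 h0.ne')
      refine hle.trans_lt ?_
      rw [map_mul, map_pow]
      calc _ ≤ 1 * v x ^ i := by
            gcongr
            simpa using v.apply_intCast_le_one (p.coeff i)
        _ < _ := by
          rw [one_mul]
          exact pow_lt_pow_right₀ hx (Finset.mem_range.1 hi)
  rw [hp.as_sum, map_add, map_pow, Polynomial.aeval_X, Polynomial.natDegree_add_eq_left_of_degree_lt]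
  · rw [v.isNonarchimedean.add_eq_left_of_lt (by simpa [q] using hq), map_pow]
    simp
  · refine (Polynomial.degree_sum_le _ _).trans_lt ?_
    simp only [Polynomial.degree_X_pow]
    refine (Finset.sup_lt_iff (WithBot.bot_lt_coe _)).2 fun i hi => ?_
    exact (Polynomial.degree_C_mul_X_pow_le _ _).trans_lt (by exact_mod_cast Finset.mem_range.1 hi)

theorem apply_one_add_pow_prime_sub_one_le {p : ℕ} (hp : p.Prime) {y : k} (hy : v y ≤ 1) :
    v ((1 + y) ^ p - 1) ≤ v y * max (v y) (v p) := by
  obtain ⟨r, hr⟩ := exists_add_pow_prime_eq hp (1 : Polynomial ℤ) Polynomial.X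
  have h1 := congrArg (Polynomial.aeval y) hr
  simp only [map_pow, map_add, map_one, Polynomial.aeval_X, map_mul, map_natCast, one_pow,
    mul_one] at h1
  have h2 : (1 + y) ^ p - 1 = y ^ p + y * (p * Polynomial.aeval y r) := by rw [h1]; ring
  rw [h2, mul_max_of_nonneg _ _ (by positivity)]
  refine (FinitePlace.add_le v _ _).trans (max_le_max ?_ ?_)
  · rw [map_pow, ← sq]
    exact pow_le_pow_of_le_one (by positivity) hy hp.two_le
  · rw [map_mul, map_mul]
    gcongr
    exact mul_le_of_le_one_right (by positivity) (v.apply_aeval_le_one r hy)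

theorem apply_one_add_pow_prime_sub_one {p : ℕ} (hp : p.Prime) {y : k} (hy : v y < 1)
    (hyp : v y ^ (p - 1) < v p) : v ((1 + y) ^ p - 1) = v p * v y := by
  rcases eq_or_ne y 0 with rfl | hy0
  · simp
  have hvy : 0 < v y := pos_iff.2 hy0
  have hp0 : 0 < v p := pos_iff.2 (by exact_mod_cast hp.ne_zero)
  obtain ⟨r, hr⟩ := exists_add_pow_prime_eq hp (1 : Polynomial ℤ) Polynomial.X
  have hr0 : r.coeff 0 = 1 := by
    have h1 := congrArg (fun q => Polynomial.coeff q 1) hr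
    have hp1 : (1 : ℕ) ≠ p := hp.one_lt.ne
    simp only [one_pow, mul_one, Polynomial.coeff_one_add_X_pow, Nat.choose_one_right,
      Polynomial.coeff_add, Polynomial.coeff_one, Polynomial.coeff_X_pow, mul_assoc] at h1
    rw [Polynomial.coeff_natCast_mul, Polynomial.coeff_X_mul] at h1
    have h2 : (p : ℤ) ≠ 0 := by exact_mod_cast hp.ne_zero
    simp only [one_ne_zero, if_false, hp1, zero_add] at h1
    exact mul_left_cancel₀ h2 (by rw [← h1, mul_one])
  obtain ⟨s, hs⟩ : Polynomial.X ∣ r - 1 := by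
    rw [Polynomial.X_dvd_iff]; simp [hr0]
  have h3 := congrArg (Polynomial.aeval y) hr
  have h4 := congrArg (Polynomial.aeval y) hs
  simp only [map_pow, map_add, map_one, Polynomial.aeval_X, map_mul, map_natCast, one_pow, mul_one,
    map_sub] at h3 h4
  have h5 : (1 + y) ^ p - 1 = (y ^ p + p * y * (y * Polynomial.aeval y s)) + p * y := by
    rw [h3, ← h4]; ring
  rw [h5, v.isNonarchimedean.add_eq_right_of_lt, map_mul]
  refine (FinitePlace.add_le v _ _).trans_lt (max_lt ?_ ?_)
  · rw [map_pow, map_mul, ← Nat.sub_add_cancel hp.one_le, pow_succ, Nat.sub_add_cancel hp.one_le]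
    gcongr
  · rw [map_mul _ ((p : k) * y), map_mul, map_mul]
    have h6 := v.apply_aeval_le_one s hy.le
    have : v y * v (Polynomial.aeval y s) < 1 := by nlinarith
    exact mul_lt_of_lt_one_right (by positivity) this

theorem apply_one_add_pow_sub_one {y : k} (hy : v y < 1) (hyp : ∀ p : ℕ, p.Prime → v y < v p)
    (n : ℕ) : v ((1 + y) ^ n - 1) = v n * v y := by
  induction n using induction_on_primes with
  | zero => simp
  | one => simp
  | prime_mul p n hp ih =>
    have h1 : (1 + y) ^ (p * n) = (1 + ((1 + y) ^ n - 1)) ^ p := by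
      rw [add_sub_cancel, ← pow_mul, mul_comm]
    have h2 : v ((1 + y) ^ n - 1) ≤ v y := by
      rw [ih]; exact mul_le_of_le_one_left (by positivity) (v.apply_natCast_le_one n)
    have h3 : v ((1 + y) ^ n - 1) < 1 := h2.trans_lt hy
    rw [h1, v.apply_one_add_pow_prime_sub_one hp h3, ih, Nat.cast_mul, map_mul, mul_assoc]
    refine lt_of_le_of_lt ?_ (hyp p hp)
    exact (pow_le_of_le_one (by positivity) h3.le (Nat.sub_pos_of_lt hp.one_lt).ne').trans h2

theorem exists_finite_residue_hom {k : Type} [Field k] [NumberField k] (v : FinitePlace k) (R : Subring k)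
    (hR : ∀ x ∈ R, v x ≤ 1) :
    ∃ (F : Type) (_ : Field F) (_ : Finite F) (η : R →+* F), ∀ x : R, η x = 0 ↔ v x < 1 := by
  set P := v.maximalIdeal
  have hval : ∀ x : k, v x = WithZeroMulInt.toNNReal (HeightOneSpectrum.absNorm_ne_zero P) (P.valuation k x) :=
    fun x => by rw [← norm_embedding', norm_embedding_eq]
  have hmono := WithZeroMulInt.toNNReal_strictMono (HeightOneSpectrum.one_lt_absNorm_nnreal P)
  have hle : ∀ x : k, v x ≤ 1 ↔ P.valuation k x ≤ 1 := fun x => by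
    rw [hval, ← hmono.le_iff_le, map_one]; exact_mod_cast Iff.rfl
  have hlt : ∀ x : k, v x < 1 ↔ P.valuation k x < 1 := fun x => by
    rw [hval, ← hmono.lt_iff_lt, map_one]; exact_mod_cast Iff.rfl
  let O := (P.valuation k).valuationSubring
  have hmem : ∀ a : 𝓞 k, algebraMap (𝓞 k) k a ∈ O := fun a => P.valuation_le_one a
  let f : 𝓞 k →+* IsLocalRing.ResidueField O :=
    (IsLocalRing.residue O).comp ((algebraMap (𝓞 k) k).codRestrict O.toSubring hmem)
  have hres : ∀ x : O, IsLocalRing.residue O x = 0 ↔ P.valuation k (x : k) < 1 := fun x => by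
    rw [IsLocalRing.residue_eq_zero_iff]
    exact (P.valuation k).mem_maximalIdeal_iff
  have hf : Function.Surjective f := by
    intro z
    obtain ⟨x, rfl⟩ := IsLocalRing.residue_surjective z
    obtain ⟨a, ha⟩ := P.exists_valuation_sub_lt_of_integer x.2 (γ := 1)
    refine ⟨a, sub_eq_zero.1 ?_⟩
    exact (map_sub (IsLocalRing.residue O) _ _).symm.trans ((hres _).2 (by simpa using ha))
  have hker : ∀ a ∈ P.asIdeal, f a = 0 := fun a ha => by
    refine (hres _).2 ?_
    exact (P.valuation_lt_one_iff_mem a).2 ha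
  have : Finite (𝓞 k ⧸ P.asIdeal) := P.asIdeal.finiteQuotientOfFreeOfNeBot P.ne_bot
  refine ⟨IsLocalRing.ResidueField O, inferInstance,
    Finite.of_surjective _ (Ideal.Quotient.lift_surjective_of_surjective P.asIdeal hker hf),
    (IsLocalRing.residue O).comp (Subring.inclusion (S := R) (T := O.toSubring) fun x hx => (hle x).1 (hR x hx)),
    fun x => ?_⟩
  rw [hlt]
  exact hres _

theorem finprod_apply_natCast {n : ℕ} (hn : n ≠ 0) :
    ∏ᶠ w : FinitePlace k, w n = ((n : ℝ) ^ Module.finrank ℚ k)⁻¹ := by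
  rw [prod_eq_inv_abs_norm (by exact_mod_cast hn), ← map_natCast (algebraMap ℚ k), Algebra.norm_algebraMap]
  simp

theorem inv_pow_finrank_le_apply_natCast {n : ℕ} (hn : n ≠ 0) :
    ((n : ℝ) ^ Module.finrank ℚ k)⁻¹ ≤ v n := by
  classical
  have hfin : (fun w : FinitePlace k => w (n : k)).HasFiniteMulSupport :=
    hasFiniteMulSupport (by exact_mod_cast hn)
  rw [← finprod_apply_natCast hn,
    finprod_eq_prod_of_mulSupport_subset (s := insert v hfin.toFinset) _
      (fun w hw => Finset.mem_coe.2 (Finset.mem_insert_of_mem (hfin.mem_toFinset.2 hw))),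
    ← Finset.mul_prod_erase _ _ (Finset.mem_insert_self v _)]
  exact mul_le_of_le_one_right (by positivity)
    (Finset.prod_le_one (fun w _ => by positivity) fun w _ => w.apply_natCast_le_one n)

theorem mul_prime_le_one {p : ℕ} (hp : p.Prime) (hvp : v p < 1) {y : k} (hy : v y < 1) :
    v y * p ≤ 1 := by
  set P := v.maximalIdeal
  have hval : ∀ x : k, v x = WithZeroMulInt.toNNReal (HeightOneSpectrum.absNorm_ne_zero P) (P.valuation k x) :=
    fun x => by rw [← norm_embedding', norm_embedding_eq]
  have hN := HeightOneSpectrum.one_lt_absNorm_nnreal P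
  have hlt : P.valuation k y < 1 := by
    rw [hval] at hy
    exact (WithZeroMulInt.toNNReal_lt_one_iff hN).1 (by exact_mod_cast hy)
  have h1 : P.valuation k y * WithZero.exp 1 ≤ 1 := by
    rw [← WithZero.lt_mul_exp_iff_le one_ne_zero]
    gcongr
    exact WithZero.exp_pos
  have h2 := (WithZeroMulInt.toNNReal_le_one_iff hN).2 h1
  rw [map_mul] at h2
  have h3 : WithZeroMulInt.toNNReal (zero_lt_one.trans hN).ne' (WithZero.exp 1) = Ideal.absNorm P.asIdeal := by
    rw [WithZeroMulInt.toNNReal_neg_apply _ WithZero.exp_ne_zero]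
    exact zpow_one _
  rw [h3] at h2
  have h4 : v y * (Ideal.absNorm P.asIdeal : ℕ) ≤ 1 := by
    rw [hval]; exact_mod_cast h2
  refine le_trans ?_ h4
  gcongr
  by_contra! hlt'
  have hmem : v (Ideal.absNorm P.asIdeal : ℕ) < 1 := by
    rw [hval]
    have := (WithZeroMulInt.toNNReal_lt_one_iff hN).2 ((P.valuation_lt_one_iff_mem (K := k) _).2 (Ideal.absNorm_mem P.asIdeal))
    simpa using this
  have hcop := Nat.coprime_of_lt_prime (by exact_mod_cast (zero_lt_one.trans hN).ne') hlt' hp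
  exact hmem.ne (v.apply_eq_one_of_coprime hcop hvp)

/-- Away from finitely many residue characteristics, a finite place at which the value of the
`m`-th cyclotomic polynomial is small has a residue field in which `δ` has order `m`. -/
theorem apply_natCast_le_apply_eval_cyclotomic {k : Type*} [Field k] [NumberField k]
    (v : FinitePlace k)
    (hv : ∀ p : ℕ, p.Prime → v p < 1 → Module.finrank ℚ k + 1 < p)
    {R F : Type*} [CommRing R] [Field F] {f : R →+* k} {η : R →+* F} (hf : ∀ x, v (f x) ≤ 1)
    (hη : ∀ x, η x = 0 ↔ v (f x) < 1) {δ : R} {m : ℕ} (hm : 0 < m) (hord : orderOf (η δ) ≠ m)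
    (hδ : f δ ^ m ≠ 1) :
    v m ≤ v ((Polynomial.cyclotomic m k).eval (f δ)) := by
  have hev : f ((Polynomial.cyclotomic m R).eval δ) = (Polynomial.cyclotomic m k).eval (f δ) := by
    rw [← Polynomial.map_cyclotomic m f, Polynomial.eval_map_apply]
  have hev' : η ((Polynomial.cyclotomic m R).eval δ) = (Polynomial.cyclotomic m F).eval (η δ) := by
    rw [← Polynomial.map_cyclotomic m η, Polynomial.eval_map_apply]
  by_contra! hlt
  have hlt1 := hlt.trans_le (v.apply_natCast_le_one m)
  rw [← hev, ← hη, hev'] at hlt1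
  have hcast : ∀ n : ℕ, (n : F) = 0 ↔ v n < 1 := fun n => by
    rw [← map_natCast η, hη, map_natCast]
  by_cases hm0 : (m : F) = 0
  · obtain ⟨p, hp⟩ := CharP.exists F
    have hpm : p ∣ m := (CharP.cast_eq_zero_iff F p m).1 hm0
    have hp0 : p ≠ 0 := fun h => hm.ne' (Nat.eq_zero_of_zero_dvd (h ▸ hpm))
    have hpp : p.Prime := (CharP.char_is_prime_or_zero F p).resolve_right hp0
    have : Fact p.Prime := ⟨hpp⟩
    obtain ⟨n, rfl⟩ := hpm
    have hn : 0 < n := Nat.pos_of_mul_pos_left hm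
    have hvp : v p < 1 := (hcast p).1 (CharP.cast_eq_zero F p)
    have hηy : η (δ ^ n - 1) = 0 := by
      have h1 : (η δ ^ n - 1) ^ p = 0 := by
        rw [sub_pow_char, one_pow, ← pow_mul, mul_comm]
        obtain ⟨q, hq⟩ := Polynomial.cyclotomic.dvd_X_pow_sub_one (p * n) F
        have := congrArg (Polynomial.eval (η δ)) hq
        simpa [hlt1] using this
      simpa using pow_eq_zero_iff hp0 |>.1 h1
    set y := f δ ^ n - 1 with hy
    have hvy : v y < 1 := by simpa using (hη _).1 hηy
    have hy0 : y ≠ 0 := fun h => hδ (by rw [mul_comm, pow_mul, sub_eq_zero.1 h, one_pow])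
    have hyp : v y ^ (p - 1) < v p := by
      have h1 := v.mul_prime_le_one hpp hvp hvy
      have h2 := v.inv_pow_finrank_le_apply_natCast hp0
      refine lt_of_lt_of_le ?_ h2
      have hp1 : (1 : ℝ) < p := by exact_mod_cast hpp.one_lt
      calc v y ^ (p - 1) ≤ ((p : ℝ)⁻¹) ^ (p - 1) := by
            gcongr
            rwa [← one_div, le_div_iff₀ (by linarith)]
        _ < _ := by
          rw [inv_pow]
          gcongr
          · have := hv p hpp hvp
            omega
    have h3 := v.apply_one_add_pow_prime_sub_one hpp hvy hyp
    obtain ⟨q, hq⟩ := Polynomial.X_pow_sub_one_mul_cyclotomic_dvd_X_pow_sub_one_of_dvd ℤ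
      (d := n) (n := p * n) (Nat.mem_properDivisors.2 ⟨dvd_mul_left n p, by
        nlinarith [hpp.one_lt]⟩)
    have h4 := congrArg (Polynomial.aeval (f δ)) hq
    simp only [map_sub, map_mul, map_pow, Polynomial.aeval_X, map_one] at h4
    rw [← hy, show f δ ^ (p * n) = (1 + y) ^ p by rw [hy, add_sub_cancel, ← pow_mul, mul_comm],
      ← Polynomial.eval_map_algebraMap, Polynomial.map_cyclotomic] at h4
    rw [h4, map_mul, map_mul, mul_comm (v p), mul_assoc] at h3
    have h5 := mul_left_cancel₀ (pos_iff.2 hy0).ne' h3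
    have h6 : v p ≤ v ((Polynomial.cyclotomic (p * n) k).eval (f δ)) := by
      rw [← h5]
      exact mul_le_of_le_one_right (by positivity) (v.apply_aeval_le_one q (hf δ))
    refine absurd (hlt.trans_le ?_) h6.not_gt
    rw [Nat.cast_mul, map_mul]
    exact mul_le_of_le_one_right (by positivity) (v.apply_natCast_le_one n)
  · have : NeZero (m : F) := ⟨hm0⟩
    exact hord (Polynomial.isRoot_cyclotomic_iff.1 hlt1).eq_orderOf.symm

end

section

variable {k : Type} [Field k] [NumberField k] (v : FinitePlace k)

theorem exists_apply_pow_sub_one_lt_one {x : k} (hx : v x = 1) :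
    ∃ n : ℕ, 0 < n ∧ v (x ^ n - 1) < 1 := by
  obtain ⟨F, _, _, η, hη⟩ := v.exists_finite_residue_hom (Subring.closure {x})
    fun y hy => v.apply_le_one_of_mem_closure (by simp [hx]) hy
  set z : Subring.closure {x} := ⟨x, Subring.subset_closure rfl⟩
  have hz : η z ≠ 0 := fun h => ((hη z).1 h).ne hx
  have : Fintype F := Fintype.ofFinite F
  refine ⟨Fintype.card F - 1, Nat.sub_pos_of_lt Fintype.one_lt_card, ?_⟩
  exact (hη (z ^ _ - 1)).1 (by rw [map_sub, map_pow, map_one, FiniteField.pow_card_sub_one_eq_one _ hz, sub_self])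

theorem exists_forall_prime_apply_pow_sub_one_lt {x : k} (hx : v x = 1) :
    ∃ n : ℕ, 0 < n ∧ v (x ^ n - 1) < 1 ∧ ∀ p : ℕ, p.Prime → v (x ^ n - 1) < v p := by
  obtain ⟨n, hn, hlt⟩ := v.exists_apply_pow_sub_one_lt_one hx
  by_cases! hp : ∀ p : ℕ, p.Prime → 1 ≤ v p
  · exact ⟨n, hn, hlt, fun p h => hlt.trans_le (hp p h)⟩
  obtain ⟨p, hpp, hp⟩ := hp
  set ρ := max (v (x ^ n - 1)) (v p)
  have hρ : ρ < 1 := max_lt hlt hp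
  have hρ0 : 0 ≤ ρ := le_max_of_le_left (by positivity)
  have key : ∀ i : ℕ, v (x ^ (n * p ^ i) - 1) ≤ ρ ^ (i + 1) := by
    intro i
    induction i with
    | zero =>
      rw [pow_zero, mul_one, zero_add, pow_one]
      exact le_max_left _ _
    | succ i ih =>
      have h1 : x ^ (n * p ^ (i + 1)) = (1 + (x ^ (n * p ^ i) - 1)) ^ p := by
        rw [add_sub_cancel, ← pow_mul, pow_succ, mul_assoc]
      rw [h1, pow_succ]
      refine (v.apply_one_add_pow_prime_sub_one_le hpp (ih.trans (pow_le_one₀ hρ0 hρ.le))).trans ?_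
      gcongr
      exact max_le (ih.trans (pow_le_of_le_one hρ0 hρ.le (by simp))) (le_max_right _ _)
  obtain ⟨i, hi⟩ := exists_pow_lt_of_lt_one (pos_iff.2 (Nat.cast_ne_zero.2 hpp.ne_zero) : 0 < v p) hρ
  have hi' : v (x ^ (n * p ^ i) - 1) < v p :=
    ((key i).trans (pow_le_pow_of_le_one hρ0 hρ.le (Nat.le_succ i))).trans_lt hi
  refine ⟨n * p ^ i, Nat.mul_pos hn (pow_pos hpp.pos i), hi'.trans hp, fun q hq => ?_⟩
  rcases eq_or_ne p q with rfl | hpq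
  · exact hi'
  · rw [v.apply_eq_one_of_coprime ((Nat.coprime_primes hpp hq).2 hpq) hp]
    exact hi'.trans hp

theorem exists_mul_le_apply_eval_cyclotomic {δ : k} (hδ : ∀ n : ℕ, 0 < n → δ ^ n ≠ 1) :
    ∃ c : ℝ, 0 < c ∧ ∀ m : ℕ, 0 < m →
      max (v δ) 1 ^ m.totient * (c * v m) ≤ v ((Polynomial.cyclotomic m k).eval δ) := by
  have hcyc : ∀ m : ℕ, (Polynomial.cyclotomic m k).eval δ =
      Polynomial.aeval δ (Polynomial.cyclotomic m ℤ) := fun m => by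
    rw [← Polynomial.eval_map_algebraMap, Polynomial.map_cyclotomic]
  simp only [hcyc]
  rcases lt_trichotomy (v δ) 1 with h | h | h
  · refine ⟨1, one_pos, fun m hm => ?_⟩
    rw [max_eq_right h.le, one_pow, one_mul, one_mul]
    refine (v.apply_natCast_le_one m).trans ?_
    have h1 := v.apply_aeval_le_of_dvd (Polynomial.cyclotomic.dvd_X_pow_sub_one m ℤ) h.le
    rwa [map_sub, map_pow, Polynomial.aeval_X, map_one, sub_eq_add_neg,
      v.isNonarchimedean.add_eq_right_of_lt, map_neg_eq_map, map_one] at h1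
    rw [map_neg_eq_map, map_one, map_pow]
    exact pow_lt_one₀ (by positivity) h hm.ne'
  · obtain ⟨n, hn, hlt, hprime⟩ := v.exists_forall_prime_apply_pow_sub_one_lt h
    refine ⟨v (δ ^ n - 1), pos_iff.2 (sub_ne_zero.2 (hδ n hn)), fun m hm => ?_⟩
    have hdvd : Polynomial.cyclotomic m ℤ ∣ Polynomial.X ^ (n * m) - 1 :=
      (Polynomial.cyclotomic.dvd_X_pow_sub_one m ℤ).trans (by
        simpa [← pow_mul, mul_comm] using sub_dvd_pow_sub_pow (Polynomial.X ^ m : Polynomial ℤ) 1 n)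
    have h1 := v.apply_aeval_le_of_dvd hdvd h.le
    have h2 := v.apply_one_add_pow_sub_one hlt hprime m
    rw [add_sub_cancel, ← pow_mul] at h2
    rw [map_sub, map_pow, Polynomial.aeval_X, map_one, h2, mul_comm] at h1
    simpa [h] using h1
  · refine ⟨1, one_pos, fun m hm => ?_⟩
    rw [max_eq_left h.le, v.apply_aeval_of_monic (Polynomial.cyclotomic.monic m ℤ) h,
      Polynomial.natDegree_cyclotomic, one_mul]
    exact mul_le_of_le_one_right (by positivity) (v.apply_natCast_le_one m)

end

end NumberField.FinitePlace

namespace Nat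

theorem succ_pow_four_mul_prime_pow_le {p a K : ℕ} (hp : p.Prime) (ha : 0 < a)
    (hK : 16 * p ≤ K * (p - 1) ^ 4) :
    (a + 1) ^ 4 * p ^ a ≤ K * (p ^ (a - 1) * (p - 1)) ^ 4 := by
  induction a, ha using Nat.le_induction with
  | base => simpa using hK
  | succ a ha ih =>
    obtain ⟨a, rfl⟩ := Nat.exists_eq_add_of_le' ha
    simp only [Nat.add_sub_cancel] at ih ⊢
    have h1 : (a + 1 + 1 + 1) ^ 4 ≤ 8 * (a + 1 + 1) ^ 4 := by
      ring_nf; nlinarith [Nat.zero_le a, Nat.zero_le (a ^ 2), Nat.zero_le (a ^ 3), Nat.zero_le (a ^ 4)]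
    have h2 : 8 ≤ p ^ 3 := Nat.pow_le_pow_left hp.two_le 3
    calc _ ≤ (8 * (a + 1 + 1) ^ 4) * p ^ (a + 1 + 1) := by gcongr
      _ = 8 * p * ((a + 1 + 1) ^ 4 * p ^ (a + 1)) := by ring
      _ ≤ p ^ 3 * p * (K * (p ^ a * (p - 1)) ^ 4) := by gcongr
      _ = _ := by ring

theorem card_divisors_pow_four_mul_le (n : ℕ) :
    n.divisors.card ^ 4 * n ≤
      (if 2 ∣ n then 32 else 1) * (if 3 ∣ n then 3 else 1) * n.totient ^ 4 := by
  induction n using Nat.recOnPosPrimePosCoprime with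
  | prime_pow p a hp ha =>
    rw [Nat.divisors_prime_pow hp, Finset.card_map, Finset.card_range,
      Nat.totient_prime_pow hp ha]
    refine succ_pow_four_mul_prime_pow_le hp ha ?_
    have hdvd : ∀ q : ℕ, q.Prime → (q ∣ p ^ a ↔ q = p) := fun q hq => by
      rw [hq.prime.dvd_pow_iff_dvd ha.ne', Nat.prime_dvd_prime_iff_eq hq hp]
    simp only [hdvd 2 Nat.prime_two, hdvd 3 Nat.prime_three]
    split_ifs with h2 h3 h3
    · omega
    · simp [← h2]
    · simp [← h3]
    · have h4 : p ≠ 4 := by rintro rfl; norm_num at hp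
      have h5 := hp.two_le
      obtain ⟨b, rfl⟩ : ∃ b, p = b + 5 := Nat.exists_eq_add_of_le' (by omega)
      simp only [Nat.reduceSubDiff]
      ring_nf
      nlinarith [Nat.zero_le (b ^ 2), Nat.zero_le (b ^ 3), Nat.zero_le (b ^ 4)]
  | zero => simp
  | one => simp
  | coprime a b ha hb hab iha ihb =>
    rw [hab.card_divisors_mul, Nat.totient_mul hab]
    have hK : ∀ q K : ℕ, q.Prime → (if q ∣ a then K else 1) * (if q ∣ b then K else 1) =
        if q ∣ a * b then K else 1 := fun q K hq => by
      have h : ¬ (q ∣ a ∧ q ∣ b) := fun h => hq.one_lt.ne' (Nat.eq_one_of_dvd_coprimes hab h.1 h.2)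
      simp only [hq.dvd_mul]
      by_cases ha : q ∣ a <;> by_cases hb : q ∣ b <;> simp_all
    rw [← hK 2 32 Nat.prime_two, ← hK 3 3 Nat.prime_three]
    calc _ = (a.divisors.card ^ 4 * a) * (b.divisors.card ^ 4 * b) := by ring
      _ ≤ _ := Nat.mul_le_mul iha ihb
      _ = _ := by ring

/-- The number of divisors of `m` is negligible compared with the totient of `m`. -/
theorem eventually_card_divisors_mul_sq_log_lt_totient (A : ℝ) :
    ∀ᶠ m : ℕ in Filter.atTop, A * (m.divisors.card * (1 + Real.log m) ^ 2) < m.totient := by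
  have h1 : (fun x : ℝ => (1 + Real.log x) ^ 2) =o[Filter.atTop] fun x : ℝ => x ^ (1 / 4 : ℝ) := by
    have h : (fun x : ℝ => 1 + Real.log x) =o[Filter.atTop] fun x : ℝ => x ^ (1 / 8 : ℝ) :=
      .add (Asymptotics.isLittleO_const_left.2 (.inr (Filter.tendsto_abs_atTop_atTop.comp
        (tendsto_rpow_atTop (by norm_num))))) (isLittleO_log_rpow_atTop (by norm_num))
    refine (h.pow (n := 2) two_pos).congr' (.of_forall fun _ => rfl) ?_
    filter_upwards [Filter.eventually_ge_atTop 0] with x hx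
    rw [← Real.rpow_natCast, ← Real.rpow_mul hx]
    norm_num
  have h2 := (h1.comp_tendsto tendsto_natCast_atTop_atTop).def (c := (4 * (|A| + 1))⁻¹) (by positivity)
  filter_upwards [h2, Filter.eventually_gt_atTop 0] with m hm hm0
  simp only [Function.comp_apply, Real.norm_eq_abs] at hm
  have hr : 0 ≤ (m : ℝ) ^ (1 / 4 : ℝ) := by positivity
  have hs : 0 < (1 + Real.log m) ^ 2 := by
    have := Real.log_natCast_nonneg m
    positivity
  rw [abs_of_pos hs, abs_of_nonneg hr, inv_mul_eq_div, le_div_iff₀ (by positivity)] at hm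
  have hτ : (0 : ℝ) < m.divisors.card := by
    exact_mod_cast Finset.card_pos.2 (Nat.nonempty_divisors.2 hm0.ne')
  have h3 : (m.divisors.card : ℝ) * (m : ℝ) ^ (1 / 4 : ℝ) ≤ 4 * m.totient := by
    refine le_of_pow_le_pow_left₀ (n := 4) (by norm_num) (by positivity) ?_
    rw [mul_pow, mul_pow, ← Real.rpow_natCast ((m : ℝ) ^ _), ← Real.rpow_mul (by positivity)]
    norm_num
    have := card_divisors_pow_four_mul_le m
    have h : m.divisors.card ^ 4 * m ≤ 256 * m.totient ^ 4 :=
      this.trans (by gcongr; split_ifs <;> norm_num)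
    exact_mod_cast h
  have hτs := mul_pos hτ hs
  have h4 := le_abs_self A
  have h5 := mul_le_mul_of_nonneg_left hm hτ.le
  nlinarith

end Nat

namespace NumberField

theorem one_lt_mulHeight₁ {k : Type*} [Field k] [NumberField k] {δ : k}
    (hδ : Function.Injective fun n : ℕ => δ ^ n) : 1 < Height.mulHeight₁ δ := by
  by_contra! h
  refine Set.infinite_range_of_injective hδ ((finite_setOfPred_mulHeight₁_le k 1).subset ?_)
  rintro _ ⟨n, rfl⟩
  simp only [Set.mem_ofPred_eq, Height.mulHeight₁_pow]
  exact pow_le_one₀ (zero_le_one.trans (Height.one_le_mulHeight₁ δ)) h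

/-- The product formula for the value of a cyclotomic polynomial: if this value is as large as
possible at all finite places outside a fixed finite set, then the height is bounded. -/
theorem exists_mulHeight₁_pow_totient_le_exp {k : Type} [Field k] [NumberField k] {δ : k}
    (hδ : Function.Injective fun n : ℕ => δ ^ n) (S : Set (FinitePlace k)) (hS : S.Finite) :
    ∃ B : ℝ, ∀ m : ℕ, 0 < m →
      (∀ v ∉ S, max (v δ) 1 ^ m.totient * v m ≤ v ((Polynomial.cyclotomic m k).eval δ)) →
      Height.mulHeight₁ δ ^ m.totient ≤ Real.exp (B * (m.divisors.card * (1 + Real.log m) ^ 2)) := by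
  classical
  have hδ1 : ∀ n : ℕ, 0 < n → δ ^ n ≠ 1 := fun n hn h => hn.ne' (hδ (by simpa using h))
  have hδ0 : δ ≠ 0 := by
    rintro rfl
    exact absurd (@hδ 1 2 (by simp)) (by norm_num)
  choose c hc0 hc using fun v : FinitePlace k => v.exists_mul_le_apply_eval_cyclotomic hδ1
  choose C hC0 hC using fun w => exists_exp_neg_le_infinitePlace_eval_cyclotomic k hδ w
  set c₀ := ∏ v ∈ hS.toFinset, c v with hc₀
  have hc₀0 : 0 < c₀ := Finset.prod_pos fun v _ => hc0 v
  set D := Module.finrank ℚ k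
  refine ⟨|Real.log c₀| + D + ∑ w : InfinitePlace k, w.mult * C w, fun m hm hgood => ?_⟩
  set Φ := (Polynomial.cyclotomic m k).eval δ with hΦ
  set E : ℝ := m.divisors.card * (1 + Real.log m) ^ 2
  have hlog := Real.log_natCast_nonneg m
  have hτ : (1 : ℝ) ≤ m.divisors.card := by
    exact_mod_cast Finset.card_pos.2 (Nat.nonempty_divisors.2 hm.ne')
  have hE : 1 + Real.log m ≤ E := by
    calc 1 + Real.log m ≤ (1 + Real.log m) ^ 2 := by nlinarith
      _ ≤ E := le_mul_of_one_le_left (by positivity) hτ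
  have hΦ0 : Φ ≠ 0 := fun h => hδ1 m hm (by
    obtain ⟨q, hq⟩ := Polynomial.cyclotomic.dvd_X_pow_sub_one m k
    have := congrArg (Polynomial.eval δ) hq
    rw [Polynomial.eval_mul, ← hΦ, h, zero_mul] at this
    simpa [sub_eq_zero] using this)
  have hm0 : (m : k) ≠ 0 := by exact_mod_cast hm.ne'
  have hfinΦ : (fun v : FinitePlace k => v Φ).HasFiniteMulSupport := FinitePlace.hasFiniteMulSupport hΦ0
  have hfinm : (fun v : FinitePlace k => v (m : k)).HasFiniteMulSupport := FinitePlace.hasFiniteMulSupport hm0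
  have hfinδ : (fun v : FinitePlace k => v δ).HasFiniteMulSupport := FinitePlace.hasFiniteMulSupport hδ0
  set T := hS.toFinset ∪ hfinΦ.toFinset ∪ hfinm.toFinset ∪ hfinδ.toFinset with hT
  have h1 : ∏ᶠ v : FinitePlace k, v Φ = ∏ v ∈ T, v Φ :=
    finprod_eq_prod_of_mulSupport_subset _ fun v hv => by
      have := hfinΦ.mem_toFinset.2 hv
      simp only [hT, Finset.coe_union, Set.mem_union, Finset.mem_coe, this, true_or, or_true]
  have h2 : ∏ v ∈ T, v (m : k) = ((m : ℝ) ^ D)⁻¹ := by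
    rw [← FinitePlace.finprod_apply_natCast hm.ne']
    refine (finprod_eq_prod_of_mulSupport_subset _ fun v hv => ?_).symm
    have := hfinm.mem_toFinset.2 hv
    simp only [hT, Finset.coe_union, Set.mem_union, Finset.mem_coe, this, true_or, or_true]
  have h3 : ∏ᶠ v : FinitePlace k, max (v δ) 1 = ∏ v ∈ T, max (v δ) 1 :=
    finprod_eq_prod_of_mulSupport_subset _ fun v hv => by
      have : v ∈ hfinδ.toFinset := hfinδ.mem_toFinset.2 fun h => hv (by simp only [h, max_self])
      simp only [hT, Finset.coe_union, Set.mem_union, Finset.mem_coe, this, or_true]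
  have h4 : ∏ v ∈ T, (if v ∈ S then c v else 1) = c₀ := by
    rw [← Finset.prod_filter, hc₀]
    congr 1
    ext v
    simp only [hT, Finset.mem_filter, Finset.mem_union, Set.Finite.mem_toFinset]
    tauto
  have hfinite : (∏ᶠ v : FinitePlace k, max (v δ) 1) ^ m.totient * (c₀ * ((m : ℝ) ^ D)⁻¹) ≤
      ∏ᶠ v : FinitePlace k, v Φ := by
    rw [h1, h3, ← h2, ← h4, ← Finset.prod_pow, ← Finset.prod_mul_distrib, ← Finset.prod_mul_distrib]
    refine Finset.prod_le_prod (fun v _ => ?_) fun v _ => ?_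
    · have := (hc0 v).le
      split_ifs <;> positivity
    · split_ifs with hv
      · exact hc v m hm
      · rw [one_mul]; exact hgood v hv
  have hinfinite : (∏ w : InfinitePlace k, max (w δ) 1 ^ w.mult) ^ m.totient *
      Real.exp (-((∑ w : InfinitePlace k, w.mult * C w) * E)) ≤
      ∏ w : InfinitePlace k, w Φ ^ w.mult := by
    rw [Finset.sum_mul, ← Finset.sum_neg_distrib, Real.exp_sum, ← Finset.prod_pow,
      ← Finset.prod_mul_distrib]
    refine Finset.prod_le_prod (fun w _ => by positivity) fun w _ => ?_
    refine le_trans (le_of_eq ?_) (pow_le_pow_left₀ (by positivity) (hC w m hm) w.mult)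
    rw [mul_pow, ← Real.exp_nat_mul, ← pow_mul, ← pow_mul, mul_comm w.mult]
    congr 2
    ring
  have hmD : (m : ℝ) ^ D = Real.exp (D * Real.log m) := by
    rw [Real.exp_nat_mul, Real.exp_log (by exact_mod_cast hm)]
  have hprod := mul_le_mul hinfinite hfinite (by rw [h3]; positivity) (by positivity)
  rw [prod_abs_eq_one hΦ0] at hprod
  have key : Height.mulHeight₁ δ ^ m.totient *
      Real.exp (Real.log c₀ - D * Real.log m - (∑ w : InfinitePlace k, w.mult * C w) * E) ≤ 1 := by
    refine le_trans (le_of_eq ?_) hprod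
    rw [mulHeight₁_eq, Real.exp_sub, Real.exp_sub, Real.exp_log hc₀0, hmD, mul_pow, Real.exp_neg]
    ring
  rw [← le_div_iff₀ (Real.exp_pos _), one_div, ← Real.exp_neg] at key
  refine key.trans (Real.exp_le_exp.2 ?_)
  have h5 := neg_abs_le (Real.log c₀)
  have h6 : |Real.log c₀| ≤ |Real.log c₀| * E := le_mul_of_one_le_right (abs_nonneg _) (by linarith)
  have h7 : (D : ℝ) * Real.log m ≤ D * E := by gcongr; linarith
  linarith

end NumberField

/-- Let `R` be a finitely generated subring of a number field `k`, let `δ` be a non-zero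
element of `R` that is not a root of unity, and let `x 0, …, x (j-1)` be non-zero
elements of `R`.  Then there exists a positive integer `n` such that for each `m ≥ n`
there exist a finite field `F` and a ring homomorphism `η : R → F` such that the
multiplicative order of `η δ` equals `m` and `η (x i) ≠ 0` for all `i`. -/
theorem finite_field_quotients_with_prescribed_order
    (k : Type) [Field k] [NumberField k] (R : Subring k)
    (hR : ∃ s : Finset k, R = Subring.closure ↑s)
    (δ : ↥R) (hδ0 : δ ≠ 0) (hδru : ∀ n : ℕ, 0 < n → δ ^ n ≠ 1)
    (j : ℕ) (x : Fin j → ↥R) (hx : ∀ i, x i ≠ 0) :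
    ∃ n : ℕ, 0 < n ∧ ∀ m : ℕ, n ≤ m →
      ∃ (F : Type) (_ : Field F) (_ : Finite F) (η : ↥R →+* F),
        orderOf (η δ) = m ∧ ∀ i, η (x i) ≠ 0 := by
  open NumberField in
  obtain ⟨s, rfl⟩ := hR
  have hδ1 : ∀ n : ℕ, 0 < n → (δ : k) ^ n ≠ 1 := fun n hn h => hδru n hn (by exact_mod_cast h)
  have hδ0' : (δ : k) ≠ 0 := by exact_mod_cast hδ0
  have hinj : Function.Injective fun n : ℕ => (δ : k) ^ n := by
    intro a b hab
    wlog hlt : a < b generalizing a b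
    · rcases (not_lt.1 hlt).eq_or_lt with h | h
      · exact h.symm
      · exact (this hab.symm h).symm
    refine absurd ?_ (hδ1 (b - a) (Nat.sub_pos_of_lt hlt))
    simp only at hab
    rw [pow_sub₀ _ hδ0' hlt.le, ← hab, mul_inv_cancel₀ (pow_ne_zero _ hδ0')]
  have hbad : ∀ y : k, {v : FinitePlace k | y ≠ 0 ∧ v y ≠ 1}.Finite := fun y => by
    by_cases hy : y = 0
    · simp [hy]
    · exact (FinitePlace.hasFiniteMulSupport hy).subset fun v hv => hv.2
  set S : Set (FinitePlace k) := (⋃ y ∈ s, {v : FinitePlace k | y ≠ 0 ∧ v y ≠ 1}) ∪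
    (⋃ i, {v : FinitePlace k | (x i : k) ≠ 0 ∧ v (x i : k) ≠ 1}) ∪
    ⋃ p ∈ Finset.range (Module.finrank ℚ k + 2), {v : FinitePlace k | (p : k) ≠ 0 ∧ v p ≠ 1} with hS_def
  have hS : S.Finite :=
    ((s.finite_toSet.biUnion fun y _ => hbad y).union (Set.finite_iUnion fun i => hbad _)).union
      ((Finset.finite_toSet _).biUnion fun p _ => hbad _)
  obtain ⟨B, hB⟩ := exists_mulHeight₁_pow_totient_le_exp hinj S hS
  have hH1 := one_lt_mulHeight₁ hinj
  have hH := Real.log_pos hH1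
  obtain ⟨N, hN⟩ := Filter.eventually_atTop.1 (Nat.eventually_card_divisors_mul_sq_log_lt_totient
    (B / Real.log (Height.mulHeight₁ (δ : k))))
  refine ⟨N + 1, N.succ_pos, fun m hm => ?_⟩
  have hm0 : 0 < m := by omega
  by_contra! hcon
  refine (hB m hm0 fun v hv => ?_).not_gt ?_
  · simp only [hS_def, Set.mem_union, Set.mem_iUnion, Set.mem_ofPred_eq, not_or, not_exists, not_and,
      not_not, Finset.mem_range] at hv
    obtain ⟨⟨hvs, hvx⟩, hvp⟩ := hv
    have hle : ∀ y ∈ Subring.closure (s : Set k), v y ≤ 1 := fun y =>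
      v.apply_le_one_of_mem_closure fun z hz => by
        rcases eq_or_ne z 0 with rfl | hz0
        · simp
        · exact (hvs z hz hz0).le
    obtain ⟨F, _, hF, η, hη⟩ := v.exists_finite_residue_hom _ hle
    have hord : orderOf (η δ) ≠ m := fun h => by
      obtain ⟨i, hi⟩ := hcon F _ hF η h
      exact ((hη _).1 hi).ne (hvx i (by exact_mod_cast hx i))
    rw [max_eq_right (hle δ δ.2), one_pow, one_mul]
    refine v.apply_natCast_le_apply_eval_cyclotomic (fun p hp hvp' => ?_)
      (f := (Subring.closure (s : Set k)).subtype) (fun y => hle y y.2) hη hm0 hord (hδ1 m hm0)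
    by_contra! h
    exact hvp'.ne (hvp p (by omega) (by exact_mod_cast hp.ne_zero))
  · have h1 := hN m (by omega)
    rw [div_mul_eq_mul_div, div_lt_iff₀ hH] at h1
    rwa [← Real.lt_log_iff_exp_lt (pow_pos (zero_lt_one.trans hH1) _), Real.log_pow]
end

section
/- Let R be a finitely generated subring of a number field k. Let λ and ω be non-zero elements of R such that λ is not a multiplicative power of ω (i.e., λ ≠ ω^n for every integer n). Then there exist a finite ring S and a ring homomorphism η : R → S such that η(λ) is not a multiplicative power of η(ω); that is, η(λ) ≠ η(ω)^n for every non-negative integer n, and whenever η(ω) is a unit, also η(λ) ≠ η(ω)^n for every integer n. -/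
set_option synthInstance.maxHeartbeats 400000
set_option maxHeartbeats 800000

lemma exists_pos_forall_le_of_finite {ι : Type*} [Finite ι] {f : ι → ℝ} (hf : ∀ i, 0 < f i) :
    ∃ c > 0, ∀ i, c ≤ f i := by
  have h : ∀ᶠ c in nhdsWithin (0 : ℝ) (Set.Ioi 0), ∀ i, c ∈ Set.Ioc 0 (f i) :=
    Filter.eventually_all.2 fun i ↦ Ioc_mem_nhdsGT (hf i)
  obtain ⟨c, hc, hc0⟩ := (h.and self_mem_nhdsWithin).exists
  exact ⟨c, hc0, fun i ↦ (hc i).2⟩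

namespace AbsoluteValue

variable {k : Type*} [Field k]

/-- Among nearby exponents, `ω ^ t` is abnormally close to `1` at most once. -/
lemma exists_pos_le_sub_one_or_le_sub_one (v : AbsoluteValue k ℝ) {ω : k}
    (hω : ∀ n : ℕ, 0 < n → ω ^ n ≠ 1) (m : ℕ) :
    ∃ c > 0, ∀ s t : ℕ, 0 < s → s < t → t ≤ s + m →
      c * max 1 (v ω) ^ s ≤ v (ω ^ s - 1) ∨ c * max 1 (v ω) ^ t ≤ v (ω ^ t - 1) := by
  rcases lt_trichotomy (v ω) 1 with h | h | h
  · refine ⟨1 - v ω, by linarith, fun s t hs _ _ ↦ .inl ?_⟩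
    have h1 := v.le_sub 1 (ω ^ s)
    rw [v.map_sub, map_one, map_pow] at h1
    have h2 : v ω ^ s ≤ v ω := pow_le_of_le_one (v.nonneg _) h.le hs.ne'
    rw [max_eq_left h.le, one_pow]
    linarith
  · obtain ⟨c, hc, hcd⟩ := exists_pos_forall_le_of_finite
      (f := fun d : Fin m ↦ v (ω ^ (d.1 + 1) - 1) / 2) fun d ↦
        half_pos (v.pos (sub_ne_zero.2 (hω _ d.1.succ_pos)))
    refine ⟨c, hc, fun s t _ hst htm ↦ ?_⟩
    obtain ⟨d, rfl⟩ := Nat.exists_eq_add_of_lt hst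
    have h1 := hcd ⟨d, by omega⟩
    have h2 : v (ω ^ (d + 1) - 1) ≤ v (ω ^ (s + d + 1) - 1) + v (ω ^ s - 1) := by
      have h3 : v (ω ^ (d + 1) - 1) = v ((ω ^ (s + d + 1) - 1) - (ω ^ s - 1)) := by
        rw [show (ω ^ (s + d + 1) - 1) - (ω ^ s - 1) = ω ^ s * (ω ^ (d + 1) - 1) by ring,
          map_mul, map_pow, h, one_pow, one_mul]
      rw [h3]
      have h4 := v.add_le (ω ^ (s + d + 1) - 1) (-(ω ^ s - 1))
      rwa [v.map_neg, ← sub_eq_add_neg] at h4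
    simp only [h, max_self, one_pow, mul_one]
    by_contra! h4
    dsimp only at h1
    linarith [h4.1, h4.2]
  · refine ⟨1 - (v ω)⁻¹, by linarith [inv_lt_one_of_one_lt₀ h], fun s t hs _ _ ↦ .inl ?_⟩
    obtain ⟨s, rfl⟩ := Nat.exists_eq_succ_of_ne_zero hs.ne'
    have h1 := v.le_sub (ω ^ (s + 1)) 1
    rw [map_one, map_pow] at h1
    have h2 : 1 ≤ v ω ^ s := one_le_pow₀ h.le
    rw [max_eq_right h.le]
    have h3 : (1 - (v ω)⁻¹) * v ω ^ (s + 1) = v ω ^ (s + 1) - v ω ^ s := by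
      have : v ω ≠ 0 := by linarith
      rw [pow_succ]
      field_simp
    simp only [Nat.succ_eq_add_one] at *
    linarith

variable {ι : Type*} [Fintype ι] (v : ι → AbsoluteValue k ℝ)

lemma exists_pos_forall_le_sub_one {ω : k} (hω : ∀ n : ℕ, 0 < n → ω ^ n ≠ 1) :
    ∃ c > 0, ∀ T : ℕ, ∃ t > T, ∀ i, c * max 1 (v i ω) ^ t ≤ v i (ω ^ t - 1) := by
  choose c hc hcv using fun i ↦
    (v i).exists_pos_le_sub_one_or_le_sub_one hω (Fintype.card ι)
  obtain ⟨c', hc', hcc⟩ := exists_pos_forall_le_of_finite hc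
  refine ⟨c', hc', fun T ↦ ?_⟩
  have hle (i : ι) (t : ℕ) : c' * max 1 (v i ω) ^ t ≤ c i * max 1 (v i ω) ^ t :=
    mul_le_mul_of_nonneg_right (hcc i) (by positivity)
  by_contra! hbad
  choose b hb using fun j : Fin (Fintype.card ι + 1) ↦ hbad (T + 1 + j) (by omega)
  obtain ⟨j, j', hne, hbj⟩ := Fintype.exists_ne_map_eq_of_card_lt b (by simp)
  wlog hlt : j < j' generalizing j j'
  · exact this j' j hne.symm hbj.symm (lt_of_le_of_ne (not_lt.1 hlt) hne.symm)
  rcases hcv (b j) (T + 1 + j) (T + 1 + j') (by omega) (by omega) (by omega) with h | h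
  · exact (hb j).not_ge ((hle _ _).trans h)
  · exact (hb j').not_ge ((hle _ _).trans (hbj ▸ h))

/-- If `ω` has height greater than one with respect to `v`, then for suitable `t` the element
`ω ^ t - 1` is larger than `a - ω ^ m` and `a * ω ^ m - 1` for all `m ≤ t / 2`. -/
lemma exists_forall_prod_lt_prod_sub_one {ω : k} (hω : ∀ n : ℕ, 0 < n → ω ^ n ≠ 1)
    (hH : 1 < ∏ i, max 1 (v i ω)) (a : k) :
    ∃ t > 0, ∀ m : ℕ, 2 * m ≤ t →
      ∏ i, v i (a - ω ^ m) < ∏ i, v i (ω ^ t - 1) ∧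
      ∏ i, v i (a * ω ^ m - 1) < ∏ i, v i (ω ^ t - 1) := by
  obtain ⟨c, hc, hcT⟩ := exists_pos_forall_le_sub_one v hω
  set H := ∏ i, max 1 (v i ω)
  set C := ∏ i, (1 + v i a)
  have hcn : 0 < c ^ Fintype.card ι := by positivity
  obtain ⟨n, hn⟩ := pow_unbounded_of_one_lt (C / c ^ Fintype.card ι) hH
  rw [div_lt_iff₀ hcn] at hn
  obtain ⟨t, ht, hct⟩ := hcT (2 * n)
  have hprod (e : ℕ) (b : ℝ) :
      ∏ i, (b * max 1 (v i ω) ^ e) = b ^ Fintype.card ι * H ^ e := by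
    rw [Finset.prod_mul_distrib, Finset.prod_pow, Finset.prod_const, Finset.card_univ]
  refine ⟨t, by omega, fun m hm ↦ ?_⟩
  have hlow : c ^ Fintype.card ι * H ^ t ≤ ∏ i, v i (ω ^ t - 1) := by
    rw [← hprod]
    exact Finset.prod_le_prod (fun i _ ↦ by positivity) fun i _ ↦ hct i
  have hmid : C * H ^ m < c ^ Fintype.card ι * H ^ t := by
    obtain ⟨d, rfl⟩ : ∃ d, t = n + d + m := ⟨t - m - n, by omega⟩
    rw [pow_add, ← mul_assoc]
    refine mul_lt_mul_of_pos_right (hn.trans_le ?_) (by positivity)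
    rw [mul_comm]
    exact mul_le_mul_of_nonneg_left (pow_le_pow_right₀ hH.le (by omega)) hcn.le
  have hone (i : ι) : 1 ≤ max 1 (v i ω) ^ m := one_le_pow₀ (le_max_left _ _)
  have hpow (i : ι) : v i ω ^ m ≤ max 1 (v i ω) ^ m :=
    pow_le_pow_left₀ ((v i).nonneg _) (le_max_right _ _) _
  have key (x : k) (hx : ∀ i, v i x ≤ (1 + v i a) * max 1 (v i ω) ^ m) :
      ∏ i, v i x < ∏ i, v i (ω ^ t - 1) := by
    refine (Finset.prod_le_prod (fun i _ ↦ (v i).nonneg _) fun i _ ↦ hx i).trans_lt ?_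
    rw [Finset.prod_mul_distrib, Finset.prod_pow]
    exact hmid.trans_le hlow
  constructor
  · refine key _ fun i ↦ ?_
    have h1 := (v i).add_le a (-ω ^ m)
    rw [(v i).map_neg, map_pow, ← sub_eq_add_neg] at h1
    nlinarith [(v i).nonneg a, hone i, hpow i]
  · refine key _ fun i ↦ ?_
    have h1 := (v i).add_le (a * ω ^ m) (-1)
    rw [(v i).map_neg, map_mul, map_pow, map_one, ← sub_eq_add_neg] at h1
    nlinarith [(v i).nonneg a, hone i, hpow i, mul_le_mul_of_nonneg_left (hpow i) ((v i).nonneg a)]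

end AbsoluteValue

/-- A subring of a number field has finite quotients by non-zero principal ideals, being a
torsion-free group of finite rank. -/
lemma Subring.finite_quotient_span_singleton {k : Type*} [Field k] [NumberField k] (R : Subring k)
    {x : R} (hx : x ≠ 0) : Finite (R ⧸ Ideal.span {x}) := by
  have halg : Algebra.IsAlgebraic ℤ k :=
    (IsFractionRing.comap_isAlgebraic_iff (A := ℤ) (K := ℚ) (C := k)).2 inferInstance
  have hx' : IsAlgebraic ℤ x :=
    (isAlgebraic_algebraMap_iff (R := ℤ) (S := R) (A := k) Subtype.val_injective).1
      (halg.isAlgebraic (x : k))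
  obtain ⟨m, hm, hxm⟩ := hx'.exists_nonzero_dvd (mem_nonZeroDivisors_of_ne_zero hx)
  by_contra hinf
  rw [not_finite_iff_infinite] at hinf
  have : NeZero m.natAbs := ⟨by simpa using hm⟩
  set d := Module.finrank ℚ k
  let f := Infinite.natEmbedding (R ⧸ Ideal.span {x})
  let y : Fin (m.natAbs ^ d + 1) → R := fun i ↦ (f i).out
  let P : Submodule ℤ R := Submodule.span ℤ (Set.range y)
  let y' (i) : P := ⟨y i, Submodule.subset_span ⟨i, rfl⟩⟩
  have : Module.Finite ℤ P := Module.Finite.span_of_finite ℤ (Set.finite_range y)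
  let b := Module.finBasis ℤ P
  have hr : Module.finrank ℤ P ≤ d := by
    have h1 : LinearIndependent ℤ fun i ↦ ((b i : R) : k) :=
      (b.linearIndependent.map' P.subtype P.ker_subtype).map_injOn
        R.subtype.toIntAlgHom.toLinearMap Subtype.val_injective.injOn
    have h2 := ((LinearIndependent.iff_fractionRing ℤ ℚ).1 h1).fintype_card_le_finrank
    simpa using h2
  let g : Fin (m.natAbs ^ d + 1) → (Fin (Module.finrank ℤ P) → ZMod m.natAbs) := fun i j ↦
    b.repr (y' i) j
  obtain ⟨i, j, hij, hg⟩ := Fintype.exists_ne_map_eq_of_card_lt g (by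
    simp only [Fintype.card_pi, ZMod.card, Finset.prod_const, Finset.card_univ, Fintype.card_fin]
    exact Nat.lt_succ_of_le (Nat.pow_le_pow_right (NeZero.pos _) hr))
  have hdvd : x ∣ y i - y j := by
    refine hxm.trans ?_
    have h1 (l) : m ∣ b.repr (y' i - y' j) l := by
      have := congrFun hg l
      simp only [g, ZMod.intCast_eq_intCast_iff_dvd_sub] at this
      rw [Int.natCast_natAbs, abs_dvd, dvd_sub_comm] at this
      simpa using this
    choose q hq using h1
    refine ⟨((∑ l, q l • b l : P) : R), ?_⟩
    have h2 := b.sum_repr (y' i - y' j)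
    have h3 := congrArg (Subtype.val) h2
    simp only [hq, mul_smul, ← Finset.smul_sum] at h3
    simpa [y', Algebra.smul_def] using h3.symm
  apply hij
  have h1 : f i = f j := by
    have := Ideal.Quotient.eq.2 (Ideal.mem_span_singleton.2 hdvd)
    simpa [y] using this
  exact Fin.ext (f.injective h1)

open NumberField IsDedekindDomain in
/-- The index set consists of the infinite places, with multiplicity, and of the finite places at
which some generator is not integral. -/
lemma Subring.exists_absoluteValues_of_closure.{u} {k : Type u} [Field k] [NumberField k]
    (s : Finset k) :
    ∃ (ι : Type u) (_ : Fintype ι) (v : ι → AbsoluteValue k ℝ),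
      (∀ z ∈ Subring.closure (s : Set k), z ≠ 0 → 1 ≤ ∏ i, v i z) ∧
      ∀ z ∈ Subring.closure (s : Set k), z ≠ 0 → (∀ n : ℕ, 0 < n → z ^ n ≠ 1) →
        1 < ∏ i, max 1 (v i z) := by
  classical
  let S : Set (FinitePlace k) := {w | ∃ g ∈ s, 1 < w g}
  have hS : S.Finite := by
    have : S ⊆ ⋃ g ∈ s.filter (· ≠ 0), Function.mulSupport (fun w : FinitePlace k ↦ w g) := by
      rintro w ⟨g, hg, hw⟩
      simp only [Set.mem_iUnion, Finset.mem_filter]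
      refine ⟨g, ⟨hg, ?_⟩, hw.ne'⟩
      rintro rfl
      rw [map_zero] at hw
      exact hw.not_ge zero_le_one
    refine Set.Finite.subset (Set.Finite.biUnion (Finset.finite_toSet _) fun g hg ↦ ?_) this
    exact FinitePlace.hasFiniteMulSupport (Finset.mem_filter.1 hg).2
  have hout (w : FinitePlace k) (hw : w ∉ S) (z : k) (hz : z ∈ Subring.closure (s : Set k)) :
      w z ≤ 1 := by
    induction hz using Subring.closure_induction with
    | mem g hg => exact not_lt.1 fun h ↦ hw ⟨g, hg, h⟩
    | zero => simp
    | one => simp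
    | add x y _ _ hx hy => exact (FinitePlace.add_le w x y).trans (max_le hx hy)
    | neg x _ hx => rwa [map_neg_eq_map]
    | mul x y _ _ hx hy =>
      rw [map_mul]
      exact mul_le_one₀ hx (apply_nonneg _ _) hy
  have := hS.fintype
  let v : (Σ w : InfinitePlace k, Fin w.mult) ⊕ S → AbsoluteValue k ℝ :=
    Sum.elim (fun w ↦ w.1.1) fun w ↦ w.1.1
  have hvS (w : S) (z : k) : v (.inr w) z = w.1 z := rfl
  have hvI (w z) : v (.inl w) z = w.1 z := rfl
  refine ⟨_, inferInstance, v, fun z hz hz0 ↦ ?_, fun z hz hz0 hpow ↦ ?_⟩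
  · rw [Fintype.prod_sum_type]
    simp only [hvS, hvI, Fintype.prod_sigma, Finset.prod_const, Finset.card_univ, Fintype.card_fin]
    rw [← prod_abs_eq_one hz0]
    refine mul_le_mul_of_nonneg_left ?_ (by positivity)
    have hT : (Function.mulSupport fun w : FinitePlace k ↦ w z).Finite :=
      FinitePlace.hasFiniteMulSupport hz0
    rw [finprod_eq_prod_of_mulSupport_subset (s := hT.toFinset ∪ S.toFinset) _
        fun w hw ↦ by simpa using Or.inl hw,
      Finset.prod_set_coe S (f := fun w : FinitePlace k ↦ w z)]
    exact Finset.prod_le_prod_of_subset_of_le_one Finset.subset_union_right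
      (fun w _ ↦ apply_nonneg w z) fun w _ hw ↦ hout w (by simpa using hw) z hz
  · by_contra! h
    have hle (i) : v i z ≤ 1 := by
      have h1 : max 1 (v i z) ≤ ∏ i, max 1 (v i z) := by
        simpa using Finset.prod_le_prod_of_subset_of_one_le (f := fun i ↦ max 1 (v i z))
          (Finset.subset_univ {i}) (fun _ _ ↦ by positivity) fun _ _ _ ↦ le_max_left _ _
      exact (le_max_right _ _).trans (h1.trans h)
    have hfin (w : FinitePlace k) : w z ≤ 1 := by
      by_cases hw : w ∈ S
      · exact hle (.inr ⟨w, hw⟩)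
      · exact hout w hw z hz
    have hint : IsIntegral ℤ z := by
      obtain ⟨y, rfl⟩ := HeightOneSpectrum.mem_integers_of_valuation_le_one (R := 𝓞 k) k z fun w ↦ by
        have := hfin (.mk w)
        rw [FinitePlace.mk_apply, FinitePlace.norm_embedding'] at this
        exact (WithZeroMulInt.toNNReal_le_one_iff
          (NumberField.HeightOneSpectrum.one_lt_absNorm_nnreal w)).1 (mod_cast this)
      exact y.2
    obtain ⟨n, hn, hn1⟩ := Embeddings.pow_eq_one_of_norm_le_one k ℂ hz0 hint fun φ ↦ by
      have := hle (.inl ⟨.mk φ, ⟨0, InfinitePlace.mult_pos⟩⟩)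
      simpa [hvI] using this
    exact hpow n hn hn1

/-- For suitable `t`, modulo `ω ^ t - 1` the element `a` is congruent to `ω ^ m` or `ω ^ (-m)` with
`m ≤ t / 2` only if it is equal to it. -/
lemma Subring.exists_not_dvd_of_not_root_of_unity {k : Type*} [Field k] [NumberField k]
    (s : Finset k) (a ω : Subring.closure (s : Set k)) (hω0 : ω ≠ 0)
    (hω : ∀ n : ℕ, 0 < n → ω ^ n ≠ 1) :
    ∃ t > 0, ∀ m : ℕ, 2 * m ≤ t →
      (a ≠ ω ^ m → ¬ ω ^ t - 1 ∣ a - ω ^ m) ∧ (a * ω ^ m ≠ 1 → ¬ ω ^ t - 1 ∣ a * ω ^ m - 1) := by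
  obtain ⟨ι, _, v, hv, hv1⟩ := Subring.exists_absoluteValues_of_closure s
  have hω' (n : ℕ) (hn : 0 < n) : (ω : k) ^ n ≠ 1 := fun h ↦ hω n hn (Subtype.ext h)
  obtain ⟨t, ht, hlt⟩ := AbsoluteValue.exists_forall_prod_lt_prod_sub_one v hω'
    (hv1 ω ω.2 (by simpa using hω0) hω') (a : k)
  have key (x : Subring.closure (s : Set k)) (hx : x ≠ 0)
      (hxt : ∏ i, v i x < ∏ i, v i ((ω : k) ^ t - 1)) : ¬ ω ^ t - 1 ∣ x := by
    rintro ⟨z, rfl⟩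
    have hz := hv z z.2 (by simpa using right_ne_zero_of_mul hx)
    refine hxt.not_ge ?_
    push_cast
    simp only [map_mul, Finset.prod_mul_distrib]
    exact le_mul_of_one_le_right (Finset.prod_nonneg fun i _ ↦ (v i).nonneg _) hz
  refine ⟨t, ht, fun m hm ↦ ⟨fun h ↦ key _ (sub_ne_zero.2 h) ?_,
    fun h ↦ key _ (sub_ne_zero.2 h) ?_⟩⟩
  · simpa using (hlt m hm).1
  · simpa using (hlt m hm).2

/-- Powers of `u` with integer exponents reduce to exponents below `t` once `u ^ t = 1`. -/
lemma exists_lt_pow_eq_zpow {G : Type*} [Group G] {u : G} {t : ℕ} (ht : 0 < t)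
    (hu : u ^ t = 1) (n : ℤ) : ∃ r < t, u ^ n = u ^ r := by
  have h0 : (0 : ℤ) < t := by exact_mod_cast ht
  have hr := Int.emod_nonneg n h0.ne'
  have hrt := Int.emod_lt_of_pos n h0
  refine ⟨(n % t).toNat, by omega, ?_⟩
  rw [← zpow_natCast u (n % t).toNat, Int.toNat_of_nonneg hr]
  conv_lhs => rw [← Int.emod_add_mul_ediv n t, zpow_add, zpow_mul, zpow_natCast, hu]
  simp

/-- If `ω ^ t` maps to `1`, it suffices to test exponents below `t`. -/
lemma RingHom.not_power_of_forall_lt {R S : Type*} [CommRing R] [CommRing S] (η : R →+* S)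
    {a ω : R} {t : ℕ} (ht : 0 < t) (hω : η ω ^ t = 1) (h : ∀ r < t, η a ≠ η ω ^ r) :
    (∀ n : ℕ, η a ≠ η ω ^ n) ∧
      ∀ u : Sˣ, (u : S) = η ω → ∀ n : ℤ, η a ≠ ((u ^ n : Sˣ) : S) := by
  refine ⟨fun n hn ↦ ?_, fun u hu n hn ↦ ?_⟩
  · refine h (n % t) (Nat.mod_lt n ht) ?_
    rw [hn, ← Nat.mod_add_div n t, pow_add, pow_mul, hω]
    simp
  · obtain ⟨r, hr, hur⟩ := exists_lt_pow_eq_zpow ht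
      (show u ^ t = 1 from Units.ext (by simpa [hu] using hω)) n
    exact h r hr (by rw [hn, hur, Units.val_pow_eq_pow_val, hu])

/-- Let `R` be a finitely generated subring of a number field `k`, and let `λ`, `ω` be
non-zero elements of `R` such that `λ` is not an integer power of `ω` (in `k`).  Then
there exist a finite ring `S` and a ring homomorphism `η : R → S` such that `η λ` is not
a multiplicative power of `η ω`: `η λ ≠ (η ω) ^ n` for every natural number `n`, and
whenever `η ω` is a unit `u`, also `η λ ≠ u ^ n` for every integer `n`. -/
theorem finite_ring_quotient_detecting_powers
    (k : Type) [Field k] [NumberField k] (R : Subring k)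
    (hR : ∃ s : Finset k, R = Subring.closure ↑s)
    (lam ω : ↥R) (hlam : lam ≠ 0) (hω : ω ≠ 0)
    (h : ∀ n : ℤ, (lam : k) ≠ (ω : k) ^ n) :
    ∃ (S : Type) (_ : CommRing S) (_ : Finite S) (η : ↥R →+* S),
      (∀ n : ℕ, η lam ≠ (η ω) ^ n) ∧
      (∀ u : Sˣ, (u : S) = η ω → ∀ n : ℤ, η lam ≠ ((u ^ n : Sˣ) : S)) := by
  obtain ⟨s, rfl⟩ := hR
  have hpow (n : ℕ) : lam ≠ ω ^ n := fun he ↦ h n (by simp [he])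
  by_cases hroot : ∀ n : ℕ, 0 < n → ω ^ n ≠ 1
  · obtain ⟨t, ht, hdvd⟩ := Subring.exists_not_dvd_of_not_root_of_unity s lam ω hω hroot
    refine ⟨_, inferInstance, Subring.finite_quotient_span_singleton _
      (sub_ne_zero.2 (hroot t ht)), Ideal.Quotient.mk _, ?_⟩
    have hωt : Ideal.Quotient.mk (Ideal.span {ω ^ t - 1}) ω ^ t = 1 := by
      rw [← map_pow, ← map_one (Ideal.Quotient.mk _), Ideal.Quotient.eq,
        Ideal.mem_span_singleton]
    refine RingHom.not_power_of_forall_lt _ ht hωt fun r hr hlr ↦ ?_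
    by_cases hrt : 2 * r ≤ t
    · refine (hdvd r hrt).1 (hpow r) ?_
      rwa [← map_pow, Ideal.Quotient.eq, Ideal.mem_span_singleton] at hlr
    · refine (hdvd (t - r) (by omega)).2 (fun he ↦ ?_) ?_
      · refine h (-(t - r : ℕ)) ?_
        rw [zpow_neg, zpow_natCast]
        exact eq_inv_of_mul_eq_one_left (by exact_mod_cast congrArg Subtype.val he)
      · rw [← Ideal.mem_span_singleton, ← Ideal.Quotient.eq, map_mul, hlr, map_pow, ← pow_add,
          Nat.add_sub_cancel' hr.le, hωt, map_one]
  · push Not at hroot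
    obtain ⟨d, hd, hωd⟩ := hroot
    set D := ∏ i ∈ Finset.range d, (lam - ω ^ i)
    have hD0 : D ≠ 0 := Finset.prod_ne_zero_iff.2 fun i _ ↦ sub_ne_zero.2 (hpow i)
    have htwo (n : ℕ) (hn : 0 < n) : (2 : Subring.closure (s : Set k)) ^ n ≠ 1 := by
      exact_mod_cast (Nat.one_lt_two_pow hn.ne').ne'
    obtain ⟨t, ht, hdvd⟩ := Subring.exists_not_dvd_of_not_root_of_unity s (D + 1) 2
      two_ne_zero htwo
    have hDt : ¬ 2 ^ t - 1 ∣ D := by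
      simpa using (hdvd 0 (by simp)).1 (by simpa using hD0)
    refine ⟨_, inferInstance, Subring.finite_quotient_span_singleton _
      (sub_ne_zero.2 (htwo t ht)), Ideal.Quotient.mk _, ?_⟩
    refine RingHom.not_power_of_forall_lt _ hd (by rw [← map_pow, hωd, map_one]) fun r hr hlr ↦ ?_
    rw [← map_pow, Ideal.Quotient.eq, Ideal.mem_span_singleton] at hlr
    exact hDt (hlr.trans (Finset.dvd_prod_of_mem _ (Finset.mem_range.2 hr)))
end
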